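/- arXiv:1901.07028 — 6 statements merged into one kernel-verified Lean document; each statement's English description precedes it below -/
import Mathlib

section
/- A perfect matching M of a finite simple graph G is the unique perfect matching of G if and only if G contains no alternating cycle for M. -/
def IsPerfectMatching {V : Type*} (G : SimpleGraph V) (M : Set (Sym2 V)) : Prop :=
  M ⊆ G.edgeSet ∧ ∀ v : V, ∃! e, e ∈ M ∧ v ∈ e

def AltCyclic {V : Type*} {G : SimpleGraph V} (M : Set (Sym2 V)) {v : V}
    (C : G.Walk v v) : Prop :=
  ∀ i : Fin C.edges.length,
    (C.edges.get i ∈ M ↔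
      C.edges.get ⟨(i.val + 1) % C.edges.length,
        Nat.mod_lt _ (Nat.lt_of_le_of_lt (Nat.zero_le _) i.isLt)⟩ ∉ M)

namespace SimpleGraph

variable {V : Type*} {G : SimpleGraph V}

namespace Walk

lemma getVert_succ_mod_length {v : V} (C : G.Walk v v) {i : ℕ} (hi : i < C.length) :
    C.getVert ((i + 1) % C.length) = C.getVert (i + 1) := by
  obtain h | h : i + 1 < C.length ∨ i + 1 = C.length := by lia
  · rw [Nat.mod_eq_of_lt h]
  · simp [h]

lemma IsCycle.neighborSet_toSubgraph_getVert {v : V} {C : G.Walk v v} (hC : C.IsCycle) {i : ℕ}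
    (hi : i < C.length) :
    C.toSubgraph.neighborSet (C.getVert ((i + 1) % C.length)) =
      {C.getVert i, C.getVert ((i + 1) % C.length + 1)} := by
  obtain h | h : i + 1 < C.length ∨ i + 1 = C.length := by lia
  · rw [Nat.mod_eq_of_lt h, hC.neighborSet_toSubgraph_internal (by lia) h, Nat.add_sub_cancel]
  · have hi' : i = C.length - 1 := by lia
    rw [h, Nat.mod_self, getVert_zero, hC.neighborSet_toSubgraph_endpoint, Set.pair_comm, hi']

lemma exists_getVert_succ_mod_length_eq {v u : V} {C : G.Walk v v} (hC : ¬ C.Nil)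
    (hu : u ∈ C.support) : ∃ i < C.length, C.getVert ((i + 1) % C.length) = u := by
  have hpos : 0 < C.length := not_nil_iff_lt_length.mp hC
  obtain ⟨n, rfl, hn⟩ := mem_support_iff_exists_getVert.mp hu
  obtain rfl | h := Nat.eq_zero_or_pos n
  · exact ⟨C.length - 1, by lia, by simp [Nat.sub_add_cancel hpos]⟩
  · refine ⟨n - 1, by lia, ?_⟩
    rw [C.getVert_succ_mod_length (by lia), Nat.sub_add_cancel h]

lemma IsCycle.altCyclic_iff_isAlternating {v : V} {C : G.Walk v v} (hC : C.IsCycle)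
    (M : Set (Sym2 V)) :
    AltCyclic M C ↔ C.toSubgraph.spanningCoe.IsAlternating (fromEdgeSet M) := by
  have key : AltCyclic M C ↔ ∀ i < C.length,
      (s(C.getVert ((i + 1) % C.length), C.getVert i) ∈ M ↔
        s(C.getVert ((i + 1) % C.length), C.getVert ((i + 1) % C.length + 1)) ∉ M) := by
    simp only [AltCyclic, Fin.forall_iff, List.get_eq_getElem, getElem_edges, length_edges]
    refine forall₂_congr fun i hi ↦ ?_
    rw [Sym2.eq_swap, C.getVert_succ_mod_length hi]
  rw [key]
  constructor
  · intro h u w w' hww' hw hw'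
    rw [Subgraph.spanningCoe_adj] at hw hw'
    obtain ⟨i, hi, rfl⟩ := exists_getVert_succ_mod_length_eq hC.not_nil
      (mem_support_of_adj_toSubgraph hw)
    have hi' := h i hi
    simp only [fromEdgeSet_adj, hw.ne, hw'.ne, ne_eq, not_false_eq_true, and_true]
    rw [← Subgraph.mem_neighborSet, hC.neighborSet_toSubgraph_getVert hi] at hw hw'
    simp only [Set.mem_insert_iff, Set.mem_singleton_iff] at hw hw'
    grind
  · intro h i hi
    have hN := hC.neighborSet_toSubgraph_getVert hi
    have h₁ : C.toSubgraph.Adj (C.getVert ((i + 1) % C.length)) (C.getVert i) := by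
      rw [← Subgraph.mem_neighborSet, hN]; simp
    have h₂ : C.toSubgraph.Adj (C.getVert ((i + 1) % C.length))
        (C.getVert ((i + 1) % C.length + 1)) := by
      rw [← Subgraph.mem_neighborSet, hN]; simp
    have hne : C.getVert i ≠ C.getVert ((i + 1) % C.length + 1) := by
      intro he
      have := hC.ncard_neighborSet_toSubgraph_eq_two
        (C.getVert_mem_support ((i + 1) % C.length))
      simp [hN, he] at this
    simpa [h₁.ne, h₂.ne] using h hne h₁ h₂

end Walk

/-- The spanning subgraph of `G` whose edges are those of `G` lying in `M`. -/
def spanningSubgraphOfEdges (G : SimpleGraph V) (M : Set (Sym2 V)) : G.Subgraph where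
  verts := Set.univ
  Adj a b := s(a, b) ∈ M ∧ G.Adj a b
  adj_sub h := h.2
  edge_vert _ := Set.mem_univ _
  symm := ⟨fun _ _ h ↦ ⟨Sym2.eq_swap ▸ h.1, h.2.symm⟩⟩

lemma spanningCoe_spanningSubgraphOfEdges {M : Set (Sym2 V)} (hM : M ⊆ G.edgeSet) :
    (G.spanningSubgraphOfEdges M).spanningCoe = fromEdgeSet M := by
  ext a b
  simp only [spanningSubgraphOfEdges, Subgraph.spanningCoe_adj, fromEdgeSet_adj]
  exact ⟨fun h ↦ ⟨h.1, h.2.ne⟩, fun h ↦ ⟨h.1, hM h.1⟩⟩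

lemma existsUnique_mem_edge_iff (M : Set (Sym2 V)) (v : V) :
    (∃! e, e ∈ M ∧ v ∈ e) ↔ ∃! w, s(v, w) ∈ M := by
  constructor
  · rintro ⟨e, ⟨he, w, rfl⟩, huniq⟩
    exact ⟨w, he, fun y hy ↦ Sym2.congr_right.mp (huniq _ ⟨hy, Sym2.mem_mk_left v y⟩)⟩
  · rintro ⟨w, hw, huniq⟩
    refine ⟨s(v, w), ⟨hw, Sym2.mem_mk_left v w⟩, ?_⟩
    rintro _ ⟨he, y, rfl⟩
    rw [huniq y he]

lemma isPerfectMatching_spanningSubgraphOfEdges {M : Set (Sym2 V)}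
    (hM : _root_.IsPerfectMatching G M) :
    (G.spanningSubgraphOfEdges M).IsPerfectMatching := by
  rw [Subgraph.isPerfectMatching_iff]
  intro v
  obtain ⟨w, hw, huniq⟩ := (existsUnique_mem_edge_iff M v).mp (hM.2 v)
  exact ⟨w, ⟨hw, hM.1 hw⟩, fun y hy ↦ huniq y hy.1⟩

lemma isPerfectMatching_edgeSet {H : SimpleGraph V} (hle : H ≤ G)
    (hH : (⊤ : H.Subgraph).IsPerfectMatching) : _root_.IsPerfectMatching G H.edgeSet :=
  ⟨edgeSet_mono hle, fun v ↦ (existsUnique_mem_edge_iff _ v).mpr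
    (Subgraph.isPerfectMatching_iff.mp hH v)⟩

open scoped symmDiff

lemma exists_isPerfectMatching_ne_of_altCyclic {M : Set (Sym2 V)}
    (hM : _root_.IsPerfectMatching G M) {v : V} {C : G.Walk v v} (hC : C.IsCycle)
    (hA : AltCyclic M C) : ∃ M', _root_.IsPerfectMatching G M' ∧ M' ≠ M := by
  have hS := isPerfectMatching_spanningSubgraphOfEdges hM
  have hSM := spanningCoe_spanningSubgraphOfEdges hM.1
  have hA' := (hC.altCyclic_iff_isAlternating M).mp hA
  rw [← hSM] at hA'
  have hP := hS.symmDiff_of_isAlternating hA' hC.isCycles_spanningCoe_toSubgraph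
  refine ⟨_, isPerfectMatching_edgeSet (symmDiff_le_sup.trans
    (sup_le (Subgraph.spanningCoe_le _) (Subgraph.spanningCoe_le _))) hP, fun heq ↦ ?_⟩
  have hbot : C.toSubgraph.spanningCoe = ⊥ := by
    rw [← symmDiff_eq_left (a := (G.spanningSubgraphOfEdges M).spanningCoe)]
    have := congrArg fromEdgeSet heq
    rwa [fromEdgeSet_edgeSet, ← hSM] at this
  have hadj := C.toSubgraph_adj_snd hC.not_nil
  rw [← Subgraph.spanningCoe_adj, hbot] at hadj
  exact hadj

lemma exists_altCyclic_of_isPerfectMatching_ne [Finite V] {M M' : Set (Sym2 V)}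
    (hM : _root_.IsPerfectMatching G M) (hM' : _root_.IsPerfectMatching G M') (hne : M' ≠ M) :
    ∃ (v : V) (C : G.Walk v v), C.IsCycle ∧ AltCyclic M C := by
  have hS := isPerfectMatching_spanningSubgraphOfEdges hM
  have hS' := isPerfectMatching_spanningSubgraphOfEdges hM'
  have hcyc := hS.symmDiff_isCycles hS'
  have halt := hS.isAlternating_symmDiff_left hS'
  have hle := symmDiff_le_sup.trans (sup_le (G.spanningSubgraphOfEdges M).spanningCoe_le
    (G.spanningSubgraphOfEdges M').spanningCoe_le)
  have hD : (G.spanningSubgraphOfEdges M).spanningCoe ∆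
      (G.spanningSubgraphOfEdges M').spanningCoe ≠ ⊥ := by
    rw [ne_eq, symmDiff_eq_bot, spanningCoe_spanningSubgraphOfEdges hM.1,
      spanningCoe_spanningSubgraphOfEdges hM'.1]
    intro h
    have hdiag {N : Set (Sym2 V)} (hN : N ⊆ G.edgeSet) : (fromEdgeSet N).edgeSet = N := by
      rw [edgeSet_fromEdgeSet]
      exact sdiff_eq_left.mpr (Set.disjoint_left.mpr fun e he ↦ G.not_isDiag_of_mem_edgeSet (hN he))
    rw [← hdiag hM.1, ← hdiag hM'.1, h] at hne
    exact hne rfl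
  rw [spanningCoe_spanningSubgraphOfEdges hM.1] at *
  obtain ⟨v, w, hvw⟩ := ne_bot_iff_exists_adj.mp hD
  obtain ⟨C, hC, -⟩ := hcyc.exists_cycle_toSubgraph_verts_eq_connectedComponentSupp
    (ConnectedComponent.connectedComponentMk_mem (v := v)) ⟨w, hvw⟩
  refine ⟨v, C.mapLe hle, hC.mapLe hle,
    ((hC.mapLe hle).altCyclic_iff_isAlternating M).mpr (halt.mono fun a b hab ↦ ?_)⟩
  rw [Subgraph.spanningCoe_adj, Walk.adj_toSubgraph_mapLe] at hab
  exact hab.adj_sub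

end SimpleGraph

/-- A perfect matching `M` of a finite simple graph `G` is the unique perfect
matching of `G` iff `G` has no alternating cycle for `M`. -/
theorem stmt2 {V : Type*} [Fintype V] (G : SimpleGraph V) (M : Set (Sym2 V))
    (hM : IsPerfectMatching G M) :
    (∀ M', IsPerfectMatching G M' → M' = M) ↔
      ¬ ∃ (v : V) (C : G.Walk v v), C.IsCycle ∧ AltCyclic M C := by
  constructor
  · rintro h ⟨v, C, hC, hA⟩
    obtain ⟨M', hM', hne⟩ := SimpleGraph.exists_isPerfectMatching_ne_of_altCyclic hM hC hA
    exact hne (h M' hM')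
  · intro h M' hM'
    by_contra hne
    exact h (SimpleGraph.exists_altCyclic_of_isPerfectMatching_ne hM hM' hne)
end

section
/- Let G be a finite simple graph with a near-perfect matching M leaving exactly one vertex u unmatched. If G has no bridge belonging to M and no alternating cycle for M, and M is nonempty, then G contains a blossom for M with root u. -/
def IsMatching {V : Type*} (G : SimpleGraph V) (M : Set (Sym2 V)) : Prop :=
  M ⊆ G.edgeSet ∧ ∀ v : V, ∀ e ∈ M, ∀ f ∈ M, v ∈ e → v ∈ f → e = f

/-- A blossom for `M` with root `r`. -/
def IsBlossom {V : Type*} {G : SimpleGraph V} (M : Set (Sym2 V)) {r : V}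
    (C : G.Walk r r) : Prop :=
  C.IsCycle ∧ Odd C.length ∧
  (∀ x ∈ C.support, x ≠ r → ∃ e ∈ M, x ∈ e ∧ e ∈ C.edges) ∧
  (∀ e ∈ M, r ∈ e → e ∉ C.edges)

section AlternatingChains

variable {V β : Type*} (m : V → V) (N : V → V → Prop) (π : V → β)

/-- A list of vertices `x` such that traversing each `x` to its mate `m x` and then moving
along `N` to the next entry is an alternating walk. -/
abbrev AltChain (l : List V) : Prop := l.IsChain fun x y => N (m x) y

/-- A return to `a` from the vertex `o`, recorded as pairs of an entry vertex and an exit vertex,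
where the exit vertex is either the entry vertex or its mate. -/
def ReturnsTo (a : V) : V → List (V × V) → Prop
  | o, [] => N o a
  | o, (x, y) :: r => N o x ∧ (y = x ∨ y = m x) ∧ ReturnsTo a y r

open Classical in
/-- The number of pairs at which the return fails to alternate. -/
noncomputable def cusps (r : List (V × V)) : ℕ := r.countP fun e => e.2 ≠ m e.1

/-- A closed simple sequence of mate pairs through `a` alternating up to the pair of `z`. -/
structure PartialCycle (a : V) (p : List V) (z : V) (r : List (V × V)) : Prop where
  head : (p ++ [z]).head? = some a
  chain : AltChain m N (p ++ [z])
  nodup : ((p ++ z :: r.map Prod.fst).map π).Nodup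
  returns : ReturnsTo m N a (m z) r

/-- Some simple alternating chain leads from `d` to `d'` and no simple alternating chain
starting at `d'` meets it again. -/
def Precedes (d d' : V) : Prop :=
  ∃ p : List V, p.head? = some d ∧ AltChain m N (p ++ [d']) ∧ ((p ++ [d']).map π).Nodup ∧
    ∀ q, AltChain m N (d' :: q) → ((d' :: q).map π).Nodup → ∀ x ∈ q, π x ∉ p.map π

variable {m N π}

theorem AltChain.of_isInfix {l l' : List V} (h : AltChain m N l') (hl : l <:+: l') :
    AltChain m N l := by
  obtain ⟨l₁, l₂, rfl⟩ := hl
  exact h.left_of_append.right_of_append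

theorem AltChain.reverse_map (hm : ∀ x, m (m x) = x) (hN : ∀ x y, N x y → N y x) {l : List V}
    (h : AltChain m N l) : AltChain m N (l.map m).reverse := by
  rw [AltChain, List.isChain_reverse, List.isChain_map]
  refine List.IsChain.imp (fun x y hxy => ?_) h
  rw [hm]
  exact hN _ _ hxy

theorem ReturnsTo.of_append {a : V} {r₁ : List (V × V)} {x y : V} {r₂ : List (V × V)} :
    ∀ {o : V}, ReturnsTo m N a o (r₁ ++ (x, y) :: r₂) →
      (y = x ∨ y = m x) ∧ ReturnsTo m N a y r₂ := by
  induction r₁ with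
  | nil => exact fun h => h.2
  | cons e r₁ ih => exact fun h => ih h.2.2

theorem Precedes.trans {d d' d'' : V} (h : Precedes m N π d d') (h' : Precedes m N π d' d'') :
    Precedes m N π d d'' := by
  obtain ⟨p, hp, hpc, hpn, hpq⟩ := h
  obtain ⟨p', hp', hpc', hpn', hpq'⟩ := h'
  obtain ⟨t, rfl⟩ : ∃ t, p' = d' :: t := by
    cases p' with
    | nil => simp at hp'
    | cons c t => simp at hp'; exact ⟨t, by rw [hp']⟩
  have key : ∀ q, AltChain m N (d'' :: q) → ((d'' :: q).map π).Nodup →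
      ∀ x ∈ t ++ d'' :: q, π x ∉ p.map π := by
    intro q hq hqn
    refine hpq _ ?_ ?_
    · exact (List.isChain_split (l₁ := d' :: t)).2 ⟨hpc', hq⟩
    · rw [List.map_append] at hpn'
      rw [← List.cons_append, List.map_append]
      obtain ⟨h1, -, h2⟩ := List.nodup_append.1 hpn'
      refine List.nodup_append.2 ⟨h1, hqn, ?_⟩
      rintro b hb c hc rfl
      rcases List.mem_cons.1 hc with rfl | hc
      · exact h2 _ hb _ (by simp) rfl
      · obtain ⟨y, hy, rfl⟩ := List.mem_map.1 hc
        exact hpq' q hq hqn y hy hb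
  refine ⟨p ++ d' :: t, by cases p <;> simp_all, ?_, ?_, ?_⟩
  · rw [List.append_assoc]
    exact List.isChain_split.2 ⟨hpc, hpc'⟩
  · rw [List.map_append] at hpn
    obtain ⟨h1, -, h2⟩ := List.nodup_append.1 hpn
    rw [List.append_assoc, List.map_append]
    refine List.nodup_append.2 ⟨h1, hpn', ?_⟩
    rintro b hb c hc rfl
    rcases List.mem_cons.1 hc with rfl | hc
    · exact h2 _ hb _ (by simp) rfl
    · obtain ⟨y, hy, rfl⟩ := List.mem_map.1 hc
      exact key [] (by simp) (by simp) y hy hb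
  · intro q hq hqn x hx
    have h1 := key q hq hqn x (by simp [hx])
    have h2 := hpq' q hq hqn x hx
    simp only [List.map_append, List.mem_append]
    tauto

theorem Precedes.irrefl (d : V) : ¬ Precedes m N π d d := by
  rintro ⟨p, hp, -, hn, -⟩
  cases p with
  | nil => simp at hp
  | cons c t => simp at hp; subst hp; simp at hn

/-- A chain that leaves a cusp `w` and comes back to the part before `w` can be used to remove
the cusp. -/
theorem exists_partialCycle_of_meets (hm : ∀ x, m (m x) = x) (hN : ∀ x y, N x y → N y x)
    (hπ : ∀ x y, π x = π y ↔ y = x ∨ y = m x)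
    (hcyc : ∀ x l, AltChain m N (x :: (l ++ [x])) → ((x :: l).map π).Nodup → False)
    {a : V} (q : List V) : ∀ (p : List V) (w : V) (s : List V) (r : List (V × V)),
    p.head? = some a → AltChain m N (p ++ w :: (s ++ q)) →
    ((p ++ w :: (s ++ r.map Prod.fst)).map π).Nodup → ((w :: (s ++ q)).map π).Nodup →
    ReturnsTo m N a w r → (∃ y ∈ q, π y ∈ p.map π) →
    ∃ p' z' r', PartialCycle m N π a p' z' r' ∧ cusps m r' ≤ cusps m r := by
  have hπm : ∀ x, π (m x) = π x := fun x => ((hπ _ _).2 (Or.inr rfl)).symm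
  induction q with
  | nil => rintro p w s r - - - - - ⟨y, hy, -⟩; simp at hy
  | cons x q ih =>
    intro p w s r hp hc hn hq hr hy
    by_cases hxp : π x ∈ p.map π
    · obtain ⟨c, hcp, hcx⟩ := List.mem_map.1 hxp
      obtain ⟨p₁, p₂, rfl⟩ := List.append_of_mem hcp
      rcases (hπ _ _).1 hcx with rfl | rfl
      · refine (hcyc x (p₂ ++ w :: s) ?_ ?_).elim
        · refine AltChain.of_isInfix hc ⟨p₁, q, by simp⟩
        · refine hn.sublist (List.Sublist.map _ ?_)
          refine List.IsInfix.sublist ⟨p₁, r.map Prod.fst, by simp⟩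
      · refine ⟨p₁ ++ c :: (s.map m).reverse, m w, r, ⟨?_, ?_, ?_, ?_⟩, le_rfl⟩
        · cases p₁ <;> simpa using hp
        · have h1 : AltChain m N (p₁ ++ [c]) :=
            AltChain.of_isInfix hc ⟨[], p₂ ++ w :: (s ++ m c :: q), by simp⟩
          have h2 : AltChain m N (w :: s ++ [m c]) :=
            AltChain.of_isInfix hc ⟨p₁ ++ c :: p₂, q, by simp⟩
          have h3 := h2.reverse_map hm hN
          rw [List.append_assoc]
          refine List.isChain_split.2 ⟨h1, ?_⟩
          simpa [hm] using h3
        · have h1 : ((p₁ ++ c :: (w :: (s ++ r.map Prod.fst))).map π).Nodup := by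
            refine hn.sublist (List.Sublist.map _ ?_)
            simp
          refine (List.Perm.nodup_iff ?_).1 h1
          simp only [List.map_append, List.map_cons, List.map_reverse, List.map_map, hπm,
            List.append_assoc, List.cons_append]
          have : π ∘ m = π := funext hπm
          rw [this]
          refine List.Perm.append_left _ (List.Perm.cons _ ?_)
          refine (List.perm_middle (l₁ := s.map π)).symm.trans ?_
          exact List.Perm.append_right _ (List.reverse_perm _).symm
        · rwa [hm]
    · replace hy : ∃ y ∈ q, π y ∈ p.map π := by
        obtain ⟨y, hy, hyp⟩ := hy
        rcases List.mem_cons.1 hy with rfl | hy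
        · exact (hxp hyp).elim
        · exact ⟨y, hy, hyp⟩
      by_cases hxr : π x ∈ (r.map Prod.fst).map π
      · obtain ⟨x', hx', hxx'⟩ := List.mem_map.1 hxr
        obtain ⟨⟨x', y'⟩, hmem, rfl⟩ := List.mem_map.1 hx'
        obtain ⟨r₁, r₂, rfl⟩ := List.append_of_mem hmem
        obtain ⟨hy', hr₂⟩ := hr.of_append
        dsimp only at hxx' hx'
        have hle : cusps m r₂ ≤ cusps m (r₁ ++ (x', y') :: r₂) :=
          List.Sublist.countP_le (by simp [List.sublist_append_of_sublist_right])
        have hn' : (((p ++ w :: s) ++ x :: r₂.map Prod.fst).map π).Nodup := by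
          have h1 : (((p ++ w :: s) ++ x' :: r₂.map Prod.fst).map π).Nodup := by
            refine hn.sublist (List.Sublist.map _ ?_)
            simp [List.sublist_append_of_sublist_right]
          simpa [hxx'] using h1
        have hcases : y' = m x ∨ y' = x := by
          rcases (hπ _ _).1 hxx' with rfl | rfl
          · tauto
          · rw [hm]; tauto
        rcases hcases with rfl | rfl
        · refine ⟨p ++ w :: s, x, r₂, ⟨?_, ?_, hn', hr₂⟩, hle⟩
          · rw [List.append_assoc, List.head?_append, hp]; rfl
          · exact AltChain.of_isInfix hc ⟨[], q, by simp⟩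
        · obtain ⟨p', z', r', h, hle'⟩ := ih (p ++ w :: s) y' [] r₂
            (by rw [List.head?_append, hp]; rfl) (by simpa using hc) hn'
            (hq.sublist (List.Sublist.map _
              ((List.sublist_append_right s (y' :: q)).trans (List.sublist_cons_self _ _)))) hr₂
            (by obtain ⟨y, hy, hyp⟩ := hy
                exact ⟨y, hy, by rw [List.map_append]; exact List.mem_append_left _ hyp⟩)
          exact ⟨p', z', r', h, hle'.trans hle⟩
      · refine ih p w (s ++ [x]) r hp (by simpa using hc) ?_ (by simpa using hq) hr hy
        have hxs : π x ∉ (w :: s).map π := by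
          have hq' : ((w :: s).map π ++ π x :: q.map π).Nodup := by
            rwa [← List.cons_append, List.map_append] at hq
          rw [List.nodup_middle, List.nodup_cons, List.mem_append] at hq'
          exact fun h => hq'.1 (Or.inl h)
        have h1 : ((x :: (p ++ w :: s ++ r.map Prod.fst)).map π).Nodup := by
          rw [List.map_cons, List.nodup_cons]
          refine ⟨?_, by simpa using hn⟩
          rw [List.map_append, List.map_append, List.mem_append, List.mem_append]
          tauto
        refine (List.Perm.nodup_iff (List.Perm.map _ ?_)).1 h1
        have := (List.perm_middle (a := x) (l₁ := p ++ w :: s) (l₂ := r.map Prod.fst)).symm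
        simpa using this

theorem PartialCycle.exists_precedes (hm : ∀ x, m (m x) = x) (hN : ∀ x y, N x y → N y x)
    (hπ : ∀ x y, π x = π y ↔ y = x ∨ y = m x)
    (hcyc : ∀ x l, AltChain m N (x :: (l ++ [x])) → ((x :: l).map π).Nodup → False)
    {a : V} (n : ℕ) : ∀ (r : List (V × V)) (p : List V) (z : V), PartialCycle m N π a p z r →
    cusps m r = n → ∃ d, Precedes m N π a d := by
  induction n using Nat.strong_induction_on with
  | _ n ihn =>
    intro r
    induction r with
    | nil =>
      intro p z h _
      exfalso
      obtain ⟨t, ht⟩ : ∃ t, p ++ [z] = a :: t := by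
        have := h.head
        cases hl : p ++ [z] with
        | nil => simp at hl
        | cons c t => rw [hl] at this; simp at this; exact ⟨t, by rw [this]⟩
      refine hcyc a t ?_ ?_
      · rw [← List.cons_append, ← ht, List.append_assoc]
        exact List.isChain_split.2 ⟨h.chain, by simpa [ReturnsTo] using h.returns⟩
      · rw [← ht]; simpa using h.nodup
    | cons e r ihr =>
      obtain ⟨x, y⟩ := e
      intro p z h hr
      have hc : AltChain m N (p ++ [z] ++ [x]) := by
        rw [List.append_assoc]
        exact List.isChain_split.2 ⟨h.chain, by simpa [ReturnsTo] using h.returns.1⟩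
      have hn : (((p ++ [z]) ++ x :: r.map Prod.fst).map π).Nodup := by simpa using h.nodup
      by_cases hy : y = m x
      · refine ihr (p ++ [z]) x ⟨?_, hc, hn, ?_⟩ ?_
        · rw [List.head?_append, h.head]; rfl
        · rw [← hy]; exact h.returns.2.2
        · rw [← hr]; simp [cusps, hy]
      · have hyx : y = x := h.returns.2.1.resolve_right hy
        have hlt : cusps m r < n := by
          rw [← hr]; simp [cusps, hy]
        by_cases hq : ∃ q, AltChain m N (x :: q) ∧ ((x :: q).map π).Nodup ∧
            ∃ y ∈ q, π y ∈ (p ++ [z]).map π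
        · obtain ⟨q, hq, hqn, hqy⟩ := hq
          obtain ⟨p', z', r', h', hle⟩ := exists_partialCycle_of_meets hm hN hπ hcyc q (p ++ [z]) x
            [] r h.head (List.isChain_split.2 ⟨hc, hq⟩) hn hqn (hyx ▸ h.returns.2.2) hqy
          exact ihn _ (hle.trans_lt hlt) r' p' z' h' rfl
        · push Not at hq
          exact ⟨x, p ++ [z], h.head, hc,
            hn.sublist (List.Sublist.map _ (by simp)), fun q h1 h2 => hq q h1 h2⟩

theorem false_of_forall_returnsTo [Finite V] (hm : ∀ x, m (m x) = x) (hN : ∀ x y, N x y → N y x)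
    (hπ : ∀ x y, π x = π y ↔ y = x ∨ y = m x)
    (hcyc : ∀ x l, AltChain m N (x :: (l ++ [x])) → ((x :: l).map π).Nodup → False)
    (Q : V → Prop) (hQN : ∀ x y, N x y → Q y) (hQ : ∃ a, Q a)
    (hret : ∀ a, Q a → ∃ r, ReturnsTo m N a (m a) r ∧ ((a :: r.map Prod.fst).map π).Nodup) :
    False := by
  let R : V → V → Prop := fun x y => Precedes m N π y x
  have : IsTrans V R := ⟨fun _ _ _ h h' => Precedes.trans h' h⟩
  have : Std.Irrefl R := ⟨fun x => Precedes.irrefl x⟩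
  obtain ⟨a, ha, hmax⟩ := (Finite.wellFounded_of_trans_of_irrefl R).has_min {a | Q a} hQ
  obtain ⟨r, hr, hn⟩ := hret a ha
  obtain ⟨d, hd⟩ := PartialCycle.exists_precedes hm hN hπ hcyc _ r [] a
    ⟨rfl, by simp, hn, hr⟩ rfl
  refine hmax d ?_ hd
  obtain ⟨p, hp, hc, -⟩ := hd
  rcases List.eq_nil_or_concat p with rfl | ⟨p, z, rfl⟩
  · simp at hp
  · have : AltChain m N [z, d] := AltChain.of_isInfix hc ⟨p, [], by simp⟩
    simp at this
    exact hQN _ _ this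

theorem ReturnsTo.exists_cons (hm : ∀ x, m (m x) = x)
    (hπ : ∀ x y, π x = π y ↔ y = x ∨ y = m x) {a o x y : V} {r : List (V × V)}
    (hox : N o x) (hy : y = x ∨ y = m x) (hxa : π x ≠ π a) (hr : ReturnsTo m N a y r)
    (hn : ((a :: r.map Prod.fst).map π).Nodup) :
    ∃ r', ReturnsTo m N a o r' ∧ ((a :: r'.map Prod.fst).map π).Nodup := by
  by_cases hxr : π x ∈ (r.map Prod.fst).map π
  · obtain ⟨x', hx', hxx'⟩ := List.mem_map.1 hxr
    obtain ⟨⟨x', y'⟩, hmem, rfl⟩ := List.mem_map.1 hx'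
    obtain ⟨r₁, r₂, rfl⟩ := List.append_of_mem hmem
    obtain ⟨hy', hr₂⟩ := hr.of_append
    dsimp only at hxx'
    refine ⟨(x, y') :: r₂, ⟨hox, ?_, hr₂⟩, ?_⟩
    · rcases (hπ _ _).1 hxx' with rfl | rfl
      · tauto
      · rw [hm]; tauto
    · have h1 : ((a :: x' :: r₂.map Prod.fst).map π).Nodup := by
        refine hn.sublist (List.Sublist.map _ ?_)
        simp [List.sublist_append_of_sublist_right]
      simpa [hxx'] using h1
  · refine ⟨(x, y) :: r, ⟨hox, hy, hr⟩, ?_⟩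
    simp only [List.map_cons, List.nodup_cons, List.mem_cons] at hn ⊢
    exact ⟨by rintro (h | h); exacts [hxa h.symm, hn.1 h], hxr, hn.2⟩

theorem AltChain.exists_rotate {x c : V} {l : List V} (h : AltChain m N (x :: (l ++ [x])))
    (hc : c ∈ x :: l) : ∃ t, (x :: l).Perm (c :: t) ∧ AltChain m N (c :: (t ++ [c])) := by
  rcases List.mem_cons.1 hc with rfl | hc
  · exact ⟨l, List.Perm.refl _, h⟩
  · obtain ⟨l₁, l₂, rfl⟩ := List.append_of_mem hc
    refine ⟨l₂ ++ x :: l₁, ?_, ?_⟩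
    · exact (List.perm_append_comm (l₁ := x :: l₁) (l₂ := c :: l₂))
    · have h1 : AltChain m N (c :: l₂ ++ [x]) := AltChain.of_isInfix h ⟨x :: l₁, [], by simp⟩
      have h2 : AltChain m N (x :: (l₁ ++ [c])) := AltChain.of_isInfix h ⟨[], l₂ ++ [x], by simp⟩
      have := (List.isChain_split (l₁ := c :: l₂)).2 ⟨h1, h2⟩
      simpa using this

end AlternatingChains

section Matchings

variable {V : Type*} {G : SimpleGraph V} {M : Set (Sym2 V)} {u : V} {m : V → V}

theorem IsMatching.exists_mate (hM : IsMatching G M) (hu : ∀ e ∈ M, u ∉ e)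
    (hcov : ∀ v : V, v ≠ u → ∃ e ∈ M, v ∈ e) :
    ∃ m : V → V, (∀ x, m (m x) = x) ∧ m u = u ∧ ∀ x y, s(x, y) ∈ M ↔ x ≠ u ∧ y = m x := by
  classical
  have hex : ∀ v, v ≠ u → ∃ w, s(v, w) ∈ M := by
    intro v hv
    obtain ⟨e, he, hve⟩ := hcov v hv
    obtain ⟨w, rfl⟩ := hve
    exact ⟨w, he⟩
  choose! f hf using hex
  have huniq : ∀ x y z, s(x, y) ∈ M → s(x, z) ∈ M → y = z := fun x y z h h' =>
    Sym2.congr_right.1 (hM.2 x _ h _ h' (by simp) (by simp))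
  have hne : ∀ x y, s(x, y) ∈ M → x ≠ u ∧ y ≠ u := fun x y h =>
    ⟨by rintro rfl; exact hu _ h (by simp), by rintro rfl; exact hu _ h (by simp)⟩
  refine ⟨fun v => if v = u then u else f v, fun x => ?_, by simp, fun x y => ?_⟩
  · by_cases hx : x = u
    · simp [hx]
    · have h := hf x hx
      have hfx := (hne _ _ h).2
      simp only [hx, if_false, hfx]
      exact huniq _ _ _ (hf _ hfx) (by rwa [Sym2.eq_swap])
  · constructor
    · intro h
      have hx := (hne _ _ h).1
      simp only [hx, if_false]
      exact ⟨hx, huniq _ _ _ h (hf x hx)⟩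
    · rintro ⟨hx, rfl⟩
      simpa only [hx, if_false] using hf x hx

/-- A simple alternating chain avoiding the unmatched vertex is realised by an alternating path
starting and ending with matching edges. -/
theorem AltChain.exists_walk (hmm : ∀ x, m (m x) = x) (hMG : M ⊆ G.edgeSet)
    (hm : ∀ x, x ≠ u → s(x, m x) ∈ M) (l : List V) :
    ∀ x a, AltChain m (fun x y => G.Adj x y ∧ s(x, y) ∉ M) (x :: (l ++ [a])) →
    ((x :: l).map fun x => s(x, m x)).Nodup → u ∉ x :: l →
    ∃ (z : V) (W : G.Walk x z), (G.Adj z a ∧ s(z, a) ∉ M) ∧ W.IsPath ∧ Odd W.length ∧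
      (∀ (i : ℕ) (e : Sym2 V), W.edges[i]? = some e → (e ∈ M ↔ Even i)) ∧
      ∀ y ∈ W.support, s(y, m y) ∈ W.edges ∧ s(y, m y) ∈ (x :: l).map fun x => s(x, m x) := by
  induction l with
  | nil =>
    intro x a hc _ hu
    have hx := hm x (by rintro rfl; simp at hu)
    have hadj : G.Adj x (m x) := hMG hx
    refine ⟨m x, hadj.toWalk, by simpa using hc, by simpa using hadj.ne, by simp, ?_, ?_⟩
    · rintro (_ | i) e h
      · simp at h; simp [← h, hx]
      · simp at h
    · intro y hy
      simp at hy
      rcases hy with rfl | rfl <;> simp [hmm, Sym2.eq_swap]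
  | cons b l ih =>
    intro x a hc hn hu
    have hx := hm x (by rintro rfl; simp at hu)
    have hadj : G.Adj x (m x) := hMG hx
    rw [List.cons_append, AltChain, List.isChain_cons_cons] at hc
    obtain ⟨⟨hab, hM⟩, hc⟩ := hc
    rw [List.map_cons, List.nodup_cons] at hn
    obtain ⟨z, W, hz, hp, ho, he, hs⟩ := ih b a hc hn.2 (fun h => hu (List.mem_cons_of_mem _ h))
    have hxW : x ∉ W.support := fun h => hn.1 (hs x h).2
    have hmxW : m x ∉ W.support := fun h => hn.1 (by
      have := (hs _ h).2
      rwa [hmm, Sym2.eq_swap] at this)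
    refine ⟨z, .cons hadj (.cons hab W), hz, ?_, ?_, ?_, ?_⟩
    · simp [SimpleGraph.Walk.cons_isPath_iff, hp, hxW, hmxW, hadj.ne]
    · simp only [SimpleGraph.Walk.length_cons]
      grind
    · rintro (_ | _ | i) e h
      · simp at h; simp [← h, hx]
      · simp at h; simp [← h, hM]
      · simp at h
        rw [he i e h]
        grind
    · intro y hy
      simp only [SimpleGraph.Walk.support_cons, List.mem_cons, SimpleGraph.Walk.edges_cons,
        List.map_cons] at hy ⊢
      rcases hy with rfl | rfl | hy
      · simp
      · simp [hmm, Sym2.eq_swap]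
      · have := hs y hy
        rw [List.map_cons, List.mem_cons] at this
        tauto

theorem SimpleGraph.Walk.altCyclic_of_even {v : V} (C : G.Walk v v) (hC : Even C.length)
    (h : ∀ (i : ℕ) (e : Sym2 V), C.edges[i]? = some e → (e ∈ M ↔ Odd i)) : AltCyclic M C := by
  intro i
  have h1 := fun j : Fin C.edges.length => h j (C.edges.get j) (by simp)
  rw [h1, h1]
  have hi := i.isLt
  rw [← C.length_edges] at hC
  rcases Nat.lt_or_ge (i.val + 1) C.edges.length with hlt | hge
  · simp only [Nat.mod_eq_of_lt hlt]
    grind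
  · have : i.val + 1 = C.edges.length := by omega
    simp only [this, Nat.mod_self]
    grind

theorem false_of_closed_altChain (hmm : ∀ x, m (m x) = x) (hMG : M ⊆ G.edgeSet) (hmu : m u = u)
    (hu : ∀ e ∈ M, u ∉ e) (hm : ∀ x, x ≠ u → s(x, m x) ∈ M)
    (hac : ¬ ∃ (w : V) (C : G.Walk w w), C.IsCycle ∧ AltCyclic M C)
    (hbl : ¬ ∃ C : G.Walk u u, IsBlossom M C) (x : V) (l : List V)
    (hc : AltChain m (fun x y => G.Adj x y ∧ s(x, y) ∉ M) (x :: (l ++ [x])))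
    (hn : ((x :: l).map fun x => s(x, m x)).Nodup) : False := by
  by_cases hul : u ∈ x :: l
  · obtain ⟨t, hperm, hct⟩ := hc.exists_rotate hul
    replace hn := (hperm.map _).nodup_iff.1 hn
    cases t with
    | nil => simp [hmu] at hct
    | cons y t =>
      rw [List.cons_append, AltChain, List.isChain_cons_cons] at hct
      obtain ⟨⟨huy, -⟩, hct⟩ := hct
      rw [hmu] at huy
      rw [List.map_cons, List.nodup_cons] at hn
      obtain ⟨z, W, hz, hp, ho, -, hs⟩ := AltChain.exists_walk hmm hMG hm t y u hct hn.2
        (fun h => hn.1 (List.mem_map_of_mem h))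
      have huW : u ∉ W.support := fun h => hn.1 (hs u h).2
      refine hbl ⟨.cons huy (W.concat hz.1), ?_, ?_, ?_, ?_⟩
      · have hp' : (W.concat hz.1).IsPath := hp.concat huW hz.1
        refine (SimpleGraph.Walk.cons_isCycle_iff _ _).2 ⟨hp', fun h => ?_⟩
        have hswap : s(y, u) = s(u, y) := Sym2.eq_swap
        have := hp'.length_eq_one_of_mem_edges (by simpa only [hswap] using h)
        rw [SimpleGraph.Walk.length_concat] at this
        grind
      · rw [SimpleGraph.Walk.length_cons, SimpleGraph.Walk.length_concat]
        grind
      · intro v hv hvu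
        have hvW : v ∈ W.support := by
          simpa [SimpleGraph.Walk.support_concat, hvu] using hv
        refine ⟨s(v, m v), hm v hvu, by simp, ?_⟩
        simp [SimpleGraph.Walk.edges_concat, (hs v hvW).1]
      · exact fun e he hue => (hu e he hue).elim
  · obtain ⟨z, W, hz, hp, ho, he, -⟩ := AltChain.exists_walk hmm hMG hm l x x hc hn hul
    refine hac ⟨z, .cons hz.1 W, ?_, ?_⟩
    · refine (SimpleGraph.Walk.cons_isCycle_iff _ _).2 ⟨hp, fun h => ?_⟩
      have h1 := hp.length_eq_one_of_mem_edges (Sym2.eq_swap ▸ h)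
      obtain ⟨i, hi⟩ := List.mem_iff_getElem?.1 h
      have hi0 : i = 0 := by
        have := (List.getElem?_eq_some_iff.1 hi).1
        rw [W.length_edges] at this
        omega
      exact hz.2 ((he i _ hi).2 (by simp [hi0]))
    · refine SimpleGraph.Walk.altCyclic_of_even _ ?_ ?_
      · rw [SimpleGraph.Walk.length_cons]
        grind
      · rintro (_ | i) e h
        · simp at h; simp [← h, hz.2]
        · simp at h
          rw [he i e h]
          grind

/-- If the edge joining `a` to its mate is not a bridge then there is a return to `a` from its
mate. -/
theorem exists_returnsTo_of_not_isBridge (hmm : ∀ x, m (m x) = x)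
    (hM : ∀ x y, s(x, y) ∈ M ↔ x ≠ u ∧ y = m x)
    (hπ : ∀ x y, s(x, m x) = s(y, m y) ↔ y = x ∨ y = m x) {a : V} (ha : m a ≠ a)
    (hbr : ¬ G.IsBridge s(a, m a)) :
    ∃ r, ReturnsTo m (fun x y => G.Adj x y ∧ s(x, y) ∉ M) a (m a) r ∧
      ((a :: r.map Prod.fst).map fun x => s(x, m x)).Nodup := by
  set N : V → V → Prop := fun x y => G.Adj x y ∧ s(x, y) ∉ M with hN
  let π : V → Sym2 V := fun x => s(x, m x)
  let P : V → Prop := fun o => ∃ r, ReturnsTo m N a o r ∧ ((a :: r.map Prod.fst).map π).Nodup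
  have key : ∀ v, (G.deleteEdges {s(a, m a)}).Reachable v a →
      v = a ∨ P (m a) ∨ v ≠ a ∧ v ≠ m a ∧ (P v ∨ P (m v)) := by
    intro v hv
    rw [SimpleGraph.reachable_iff_reflTransGen] at hv
    induction hv using Relation.ReflTransGen.head_induction_on with
    | refl => exact Or.inl rfl
    | @head v w hvw _ ih =>
      by_cases hva : v = a
      · exact Or.inl hva
      refine Or.inr ?_
      by_cases hP : P (m a)
      · exact Or.inl hP
      rw [SimpleGraph.deleteEdges_adj, Set.mem_singleton_iff] at hvw
      obtain ⟨hadj, hne⟩ := hvw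
      rcases ih with rfl | h | ⟨hwa, hwm, hw⟩
      · have hvm : v ≠ m w := by rintro rfl; exact hne Sym2.eq_swap
        refine Or.inr ⟨hva, hvm, Or.inl ⟨[], ⟨hadj, ?_⟩, by simp⟩⟩
        rw [hM]
        rintro ⟨-, h⟩
        exact hvm (by rw [h, hmm])
      · exact Or.inl h
      · by_cases hwv : w = m v
        · subst hwv
          refine Or.inr ⟨hva, ?_, ?_⟩
          · rintro rfl; exact hwa (hmm _)
          · rw [hmm] at hw; exact hw.symm
        · have hPv : P v := by
            have hNvw : N v w := ⟨hadj, fun h => hwv ((hM _ _).1 h).2⟩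
            have hwπ : π w ≠ π a := by
              intro h
              rcases (hπ _ _).1 h with h | h
              · exact hwa h.symm
              · exact hwm (by rw [h, hmm])
            rcases hw with ⟨r, hr, hn⟩ | ⟨r, hr, hn⟩
            · exact ReturnsTo.exists_cons hmm hπ hNvw (Or.inl rfl) hwπ hr hn
            · exact ReturnsTo.exists_cons hmm hπ hNvw (Or.inr rfl) hwπ hr hn
          refine Or.inr ⟨hva, ?_, Or.inl hPv⟩
          rintro rfl
          exact hP hPv
  rw [SimpleGraph.isBridge_iff, not_not] at hbr
  rcases key _ hbr.symm with h | h | ⟨-, h, -⟩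
  · exact (ha h).elim
  · exact h
  · exact (h rfl).elim

end Matchings

/-- If `M` is a nonempty near-perfect matching of `G` leaving exactly the
vertex `u` unmatched, with no bridge of `G` in `M` and no alternating cycle for
`M`, then `G` contains a blossom for `M` rooted at `u`. -/
theorem stmt8 {V : Type*} [Fintype V] (G : SimpleGraph V) (M : Set (Sym2 V))
    (u : V) (hM : IsMatching G M)
    (hu : ∀ e ∈ M, u ∉ e) (hcov : ∀ v : V, v ≠ u → ∃ e ∈ M, v ∈ e)
    (hbr : ∀ e ∈ M, ¬ G.IsBridge e)
    (hac : ¬ ∃ (w : V) (C : G.Walk w w), C.IsCycle ∧ AltCyclic M C)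
    (hne : M.Nonempty) :
    ∃ C : G.Walk u u, IsBlossom M C := by
  by_contra hbl
  obtain ⟨m, hmm, hmu, hMm⟩ := hM.exists_mate hu hcov
  have hm : ∀ x, x ≠ u → s(x, m x) ∈ M := fun x hx => (hMm _ _).2 ⟨hx, rfl⟩
  have hπ : ∀ x y, s(x, m x) = s(y, m y) ↔ y = x ∨ y = m x := by
    intro x y
    rw [Sym2.eq_iff]
    constructor
    · rintro (h | h)
      · exact Or.inl h.1.symm
      · exact Or.inr h.2.symm
    · rintro (rfl | rfl) <;> simp [hmm]
  refine false_of_forall_returnsTo (N := fun x y => G.Adj x y ∧ s(x, y) ∉ M) hmm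
    (fun x y h => ⟨h.1.symm, by rw [Sym2.eq_swap]; exact h.2⟩) hπ
    (false_of_closed_altChain hmm hM.1 hmu hu hm hac hbl)
    (fun a => a ≠ u ∨ ∃ y, G.Adj y a ∧ s(y, a) ∉ M) (fun x y h => Or.inr ⟨x, h⟩) ?_ ?_
  · obtain ⟨e, he⟩ := hne
    induction e with
    | _ x y => exact ⟨x, Or.inl ((hMm x y).1 he).1⟩
  · intro a ha
    by_cases hau : a = u
    · subst hau
      obtain ⟨y, hy⟩ := ha.resolve_left (fun h => h rfl)
      refine ⟨[(y, y)], ⟨?_, Or.inl rfl, hy⟩, ?_⟩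
      · rw [hmu]
        exact ⟨hy.1.symm, by rw [Sym2.eq_swap]; exact hy.2⟩
      · have : ¬ s(a, m a) = s(y, m y) := by
          rw [hπ, hmu, or_self]
          exact hy.1.ne
        simpa using this
    · exact exists_returnsTo_of_not_isBridge hmm hMm hπ (SimpleGraph.Adj.ne (hM.1 (hm a hau))).symm
        (hbr _ (hm a hau))
end

section
/- Let G be a finite simple graph with a matching M such that there are no alternating cycles for M and exactly two unmatched vertices u and v, and let e = (a,b) ∈ M. Then there exists an augmenting path for M in G crossing the edge e if and only if the graph G' = G − e (deleting the edge e but keeping its endpoints) has a perfect matching. -/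
def AltList {V : Type*} (M : Set (Sym2 V)) (l : List (Sym2 V)) : Prop :=
  List.Chain' (fun e f => (e ∈ M ↔ f ∉ M)) l

namespace SimpleGraph

variable {V : Type*} {G : SimpleGraph V}

/-- In a trail, if distinct edges sharing a vertex always alternate, so do consecutive edges. -/
theorem Walk.IsTrail.altList {M : Set (Sym2 V)} {x y : V} {p : G.Walk x y} (hp : p.IsTrail)
    (h : ∀ e ∈ p.edges, ∀ f ∈ p.edges, ∀ z ∈ e, z ∈ f → e ≠ f → (e ∈ M ↔ f ∉ M)) :
    AltList M p.edges := by
  refine List.isChain_iff_getElem.mpr fun i hi => ?_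
  refine h _ (List.getElem_mem _) _ (List.getElem_mem _) (p.getVert (i + 1)) ?_ ?_ ?_
  · simp [Walk.getElem_edges]
  · simp [Walk.getElem_edges]
  · rw [Ne, hp.edges_nodup.getElem_inj_iff]
    lia

theorem Walk.IsCycle.altCyclic {M : Set (Sym2 V)} {x : V} {p : G.Walk x x} (hp : p.IsCycle)
    (h : ∀ e ∈ p.edges, ∀ f ∈ p.edges, ∀ z ∈ e, z ∈ f → e ≠ f → (e ∈ M ↔ f ∉ M)) :
    AltCyclic M p := by
  rintro ⟨i, hi⟩
  have h3 := hp.three_le_length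
  have hlen := p.length_edges
  refine h _ (List.get_mem _ _) _ (List.get_mem _ _) (p.getVert (i + 1)) ?_ ?_ ?_
  · simp [Walk.getElem_edges]
  · rw [List.get_eq_getElem, Walk.getElem_edges]
    rcases Nat.lt_or_ge (i + 1) p.edges.length with hlt | hge
    · simp [Nat.mod_eq_of_lt (hlen ▸ hlt)]
    · have hi' : i + 1 = p.edges.length := by lia
      simp [hi', hlen]
  · rw [List.get_eq_getElem, List.get_eq_getElem, Ne, hp.edges_nodup.getElem_inj_iff]
    rcases Nat.lt_or_ge (i + 1) p.edges.length with hlt | hge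
    · simp [Nat.mod_eq_of_lt (hlen ▸ hlt)]
    · have hi' : i + 1 = p.edges.length := by lia
      simp only [hi', Nat.mod_self]
      lia

/-- In a finite forest all of whose leaves lie in `T`, each edge is on a path with both ends
in `T`. -/
theorem IsAcyclic.exists_isPath_ends_mem [Finite V] (hG : G.IsAcyclic) {T : Set V}
    (hT : ∀ x ∉ T, ∀ e ∈ G.edgeSet, x ∈ e → ∃ f ∈ G.edgeSet, x ∈ f ∧ f ≠ e)
    {e : Sym2 V} (he : e ∈ G.edgeSet) :
    ∃ x ∈ T, ∃ y ∈ T, ∃ p : G.Walk x y, p.IsPath ∧ e ∈ p.edges := by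
  classical
  have := Fintype.ofFinite V
  let Q : ℕ → Prop := fun n => ∃ (x y : V) (p : G.Walk x y),
    p.IsPath ∧ e ∈ p.edges ∧ p.length = n
  have hQ : Q 1 := by
    induction e with
    | _ a b =>
      have hab : G.Adj a b := he
      exact ⟨a, b, hab.toWalk, by simp [Walk.cons_isPath_iff, hab.ne], by simp, by simp⟩
  have hbound : ∀ n, Q n → n ≤ Fintype.card V := by
    rintro n ⟨x, y, p, hp, -, rfl⟩
    exact hp.length_lt.le
  obtain ⟨x, y, p, hp, hep, hlen⟩ := Nat.findGreatest_spec (hbound 1 hQ) hQ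
  have hmax : ∀ (x' y' : V) (q : G.Walk x' y'), q.IsPath → e ∈ q.edges → q.length ≤ p.length := by
    intro x' y' q hq heq
    have hn : Q q.length := ⟨x', y', q, hq, heq, rfl⟩
    exact hlen ▸ Nat.le_findGreatest (hbound _ hn) hn
  have hstart : ∀ (x' y' : V) (q : G.Walk x' y'), q.IsPath → e ∈ q.edges →
      q.length = p.length → x' ∈ T := by
    intro x' y' q hq heq hql
    by_contra hx'
    cases q with
    | nil => simp at heq
    | @cons _ z _ hadj r =>
      obtain ⟨f, hf, hxf, hne⟩ := hT x' hx' s(x', z) hadj (by simp)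
      obtain ⟨w, rfl⟩ := hxf
      have hw : G.Adj w x' := (show G.Adj x' w from hf).symm
      have hpath : (Walk.cons hw (Walk.cons hadj r)).IsPath := by
        rw [hG.isPath_iff_isChain] at hq ⊢
        rw [Walk.edges_cons, Walk.edges_cons, List.isChain_cons_cons]
        exact ⟨by rwa [Sym2.eq_swap], hq⟩
      have := hmax _ _ _ hpath (by rw [Walk.edges_cons]; exact List.mem_cons_of_mem _ heq)
      rw [Walk.length_cons] at this
      lia
  exact ⟨x, hstart x y p hp hep rfl, y,
    hstart y x p.reverse hp.reverse (by simpa using hep) (by simp), p, hp, hep⟩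

end SimpleGraph

section

open SimpleGraph

variable {V : Type*} {G : SimpleGraph V} {M : Set (Sym2 V)} {u v : V}

/-- In an alternating list starting outside `M`, the members of `M` are those of odd index. -/
theorem AltList.getElem_mem_iff_odd {l : List (Sym2 V)} (hl : AltList M l)
    (h0 : ∀ h : 0 < l.length, l[0] ∉ M) (i : ℕ) (hi : i < l.length) :
    l[i] ∈ M ↔ Odd i := by
  induction i with
  | zero => simpa using h0 hi
  | succ i ih =>
    have := List.isChain_iff_getElem.mp hl i hi
    have := ih (by lia)
    grind

theorem IsMatching.isPerfectMatching_symmDiff (hM : IsMatching G M) (huv : u ≠ v)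
    (hu : ∀ e ∈ M, u ∉ e) (hv : ∀ e ∈ M, v ∉ e)
    (hcov : ∀ w : V, w ≠ u → w ≠ v → ∃ e ∈ M, w ∈ e)
    {P : G.Walk u v} (hP : P.IsPath) (hA : AltList M P.edges) :
    IsPerfectMatching G (symmDiff M {e | e ∈ P.edges}) := by
  have hlen := P.length_edges
  have hpos : 0 < P.length := Nat.pos_of_ne_zero fun h => huv (Walk.eq_of_length_eq_zero h)
  have hodd : ∀ i (hi : i < P.edges.length), P.edges[i] ∈ M ↔ Odd i :=
    hA.getElem_mem_iff_odd fun h h0 => hu _ h0 (by simp [Walk.getElem_edges])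
  have hlast : Odd P.length := by
    have hl := hodd (P.length - 1) (by lia)
    have : P.edges[P.length - 1] ∉ M := fun h => hv _ h <| by
      simp [Walk.getElem_edges, Nat.sub_add_cancel hpos]
    grind
  have hinc : ∀ i (hi : i < P.edges.length) j, j ≤ P.length →
      (P.getVert j ∈ P.edges[i] ↔ j = i ∨ j = i + 1) := by
    intro i hi j hj
    rw [Walk.getElem_edges, Sym2.mem_iff]
    exact or_congr (hP.getVert_injOn.eq_iff hj (show i ≤ P.length by lia))
      (hP.getVert_injOn.eq_iff hj (show i + 1 ≤ P.length by lia))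
  refine ⟨?_, fun w => ?_⟩
  · rintro e (⟨h, -⟩ | ⟨h, -⟩)
    exacts [hM.1 h, P.edges_subset_edgeSet h]
  by_cases hw : w ∈ P.support
  · obtain ⟨j, rfl, hj⟩ := Walk.mem_support_iff_exists_getVert.mp hw
    have hMP : ∀ e ∈ M, P.getVert j ∈ e → e ∈ P.edges := by
      intro e he hje
      have hj0 : j ≠ 0 := by rintro rfl; exact hu e he (by simpa using hje)
      have hjn : j ≠ P.length := by rintro rfl; exact hv e he (by simpa using hje)
      obtain ⟨i, hi, hiM, hji⟩ : ∃ i, ∃ hi : i < P.edges.length,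
          P.edges[i] ∈ M ∧ P.getVert j ∈ P.edges[i] := by
        rcases Nat.even_or_odd j with hje | hjo
        · have hj1 : j - 1 < P.edges.length := by lia
          exact ⟨j - 1, hj1, (hodd _ hj1).mpr (by grind),
            (hinc _ hj1 j hj).mpr (by lia)⟩
        · have hj1 : j < P.edges.length := by lia
          exact ⟨j, hj1, (hodd _ hj1).mpr hjo, (hinc _ hj1 j hj).mpr (by lia)⟩
      rw [hM.2 _ e he _ hiM hje hji]
      exact List.getElem_mem hi
    have hk : ∃ k, k < P.edges.length ∧ Even k ∧ (j = k ∨ j = k + 1) := by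
      rcases Nat.even_or_odd j with hje | hjo
      · exact ⟨j, by grind, hje, by lia⟩
      · exact ⟨j - 1, by grind, by grind, by grind⟩
    obtain ⟨k, hk, hke, hjk⟩ := hk
    refine ⟨P.edges[k], ⟨Or.inr ⟨List.getElem_mem hk, ?_⟩, (hinc k hk j hj).mpr hjk⟩, ?_⟩
    · rw [hodd]
      grind
    · rintro e ⟨⟨heM, heP⟩ | ⟨heP, heM⟩, hje⟩
      · exact absurd (hMP e heM hje) heP
      · obtain ⟨i, hi, rfl⟩ := List.mem_iff_getElem.mp heP
        rw [hodd] at heM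
        rw [hinc i hi j hj] at hje
        have : i = k := by grind
        simp [this]
  · have hnot : ∀ e ∈ P.edges, w ∉ e := fun e he hwe =>
      hw (Walk.mem_support_of_mem_edges he hwe)
    obtain ⟨e, he, hwe⟩ := hcov w (fun h => hw (h ▸ P.start_mem_support))
      (fun h => hw (h ▸ P.end_mem_support))
    refine ⟨e, ⟨Or.inl ⟨he, fun h => hnot e h hwe⟩, hwe⟩, ?_⟩
    rintro f ⟨⟨hf, -⟩ | ⟨hf, -⟩, hwf⟩
    · exact hM.2 w f hf e he hwf hwe
    · exact absurd hwf (hnot f hf)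

theorem IsMatching.exists_augmenting_path_of_isPerfectMatching [Finite V] (hM : IsMatching G M)
    (hcov : ∀ w : V, w ≠ u → w ≠ v → ∃ e ∈ M, w ∈ e)
    (hac : ¬ ∃ (w : V) (C : G.Walk w w), C.IsCycle ∧ AltCyclic M C)
    {M' : Set (Sym2 V)} (hM' : IsPerfectMatching G M') {e : Sym2 V} (he : e ∈ M) (he' : e ∉ M') :
    ∃ P : G.Walk u v, P.IsPath ∧ AltList M P.edges ∧ e ∈ P.edges := by
  have hsub : symmDiff M M' ⊆ G.edgeSet := by
    rintro f (⟨h, -⟩ | ⟨h, -⟩)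
    exacts [hM.1 h, hM'.1 h]
  have hH : (fromEdgeSet (symmDiff M M')).edgeSet = symmDiff M M' := by
    rw [edgeSet_fromEdgeSet, sdiff_eq_left, Set.disjoint_left]
    exact fun f hf => G.not_isDiag_of_mem_edgeSet (hsub hf)
  set H := fromEdgeSet (symmDiff M M')
  have hle : H ≤ G := by rwa [← edgeSet_subset_edgeSet, hH]
  have halt : ∀ f ∈ symmDiff M M', ∀ g ∈ symmDiff M M', ∀ z ∈ f, z ∈ g → f ≠ g →
      (f ∈ M ↔ g ∉ M) := by
    intro f hf g hg z hzf hzg hne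
    have h1 := fun hf hg => hne (hM.2 z f hf g hg hzf hzg)
    have h2 := fun hf hg => hne ((hM'.2 z).unique (y₁ := f) (y₂ := g) ⟨hf, hzf⟩ ⟨hg, hzg⟩)
    rw [Set.mem_symmDiff] at hf hg
    tauto
  have haltH : ∀ {x y : V} (p : H.Walk x y), ∀ f ∈ (p.mapLe hle).edges,
      ∀ g ∈ (p.mapLe hle).edges, ∀ z ∈ f, z ∈ g → f ≠ g → (f ∈ M ↔ g ∉ M) := by
    intro x y p f hf g hg
    rw [Walk.edges_mapLe_eq_edges] at hf hg
    exact halt f (hH ▸ p.edges_subset_edgeSet hf) g (hH ▸ p.edges_subset_edgeSet hg)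
  have hacyc : H.IsAcyclic := fun w C hC =>
    hac ⟨w, C.mapLe hle, hC.mapLe hle, (hC.mapLe hle).altCyclic (haltH C)⟩
  have hleaf : ∀ x ∉ ({u, v} : Set V), ∀ f ∈ H.edgeSet, x ∈ f →
      ∃ g ∈ H.edgeSet, x ∈ g ∧ g ≠ f := by
    intro x hx f hf hxf
    simp only [Set.mem_insert_iff, Set.mem_singleton_iff, not_or] at hx
    obtain ⟨m, hm, hxm⟩ := hcov x hx.1 hx.2
    obtain ⟨m', ⟨hm', hxm'⟩, huniq⟩ := hM'.2 x
    rw [hH] at hf ⊢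
    rcases hf with ⟨hfM, hfM'⟩ | ⟨hfM', hfM⟩
    · have hne : m' ≠ f := fun h => hfM' (h ▸ hm')
      exact ⟨m', Or.inr ⟨hm', fun h => hne (hM.2 x _ h _ hfM hxm' hxf)⟩, hxm', hne⟩
    · have hne : m ≠ f := fun h => hfM (h ▸ hm)
      exact ⟨m, Or.inl ⟨hm, fun h => hne
        ((huniq m ⟨h, hxm⟩).trans (huniq f ⟨hfM', hxf⟩).symm)⟩, hxm, hne⟩
  have heH : e ∈ H.edgeSet := by rw [hH]; exact Or.inl ⟨he, he'⟩
  obtain ⟨x, hx, y, hy, p, hp, hep⟩ := hacyc.exists_isPath_ends_mem hleaf heH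
  have hxy : x ≠ y := by
    rintro rfl
    simp [Walk.edges_eq_nil.mpr (Walk.isPath_iff_nil.mp hp)] at hep
  obtain ⟨q, hq, heq⟩ : ∃ q : H.Walk u v, q.IsPath ∧ e ∈ q.edges := by
    rcases hx with rfl | rfl <;> rcases hy with rfl | rfl
    · exact absurd rfl hxy
    · exact ⟨p, hp, hep⟩
    · exact ⟨p.reverse, hp.reverse, by simpa using hep⟩
    · exact absurd rfl hxy
  exact ⟨q.mapLe hle, hq.mapLe hle, (hq.mapLe hle).isTrail.altList (haltH q), by
    rwa [Walk.edges_mapLe_eq_edges]⟩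

end

/-- For a matching `M` with no alternating cycle and exactly two unmatched
vertices `u, v`, and a matching edge `e = (a,b)`, there is an augmenting path
for `M` crossing `e` iff `G − e` has a perfect matching. -/
theorem stmt9 {V : Type*} [Fintype V] (G : SimpleGraph V) (M : Set (Sym2 V))
    (hM : IsMatching G M) (u v : V) (huv : u ≠ v)
    (hu : ∀ e ∈ M, u ∉ e) (hv : ∀ e ∈ M, v ∉ e)
    (hcov : ∀ w : V, w ≠ u → w ≠ v → ∃ e ∈ M, w ∈ e)
    (hac : ¬ ∃ (w : V) (C : G.Walk w w), C.IsCycle ∧ AltCyclic M C)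
    (a b : V) (he : s(a, b) ∈ M) :
    (∃ P : G.Walk u v, P.IsPath ∧ AltList M P.edges ∧ s(a, b) ∈ P.edges) ↔
      ∃ M', IsPerfectMatching (G.deleteEdges {s(a, b)}) M' := by
  constructor
  · rintro ⟨P, hP, hA, heP⟩
    obtain ⟨hsub, hperf⟩ := hM.isPerfectMatching_symmDiff huv hu hv hcov hP hA
    refine ⟨_, fun e h => ?_, hperf⟩
    rw [SimpleGraph.edgeSet_deleteEdges]
    refine ⟨hsub h, ?_⟩
    rintro rfl
    rw [Set.mem_symmDiff] at h
    exact h.elim (fun h => h.2 heP) (fun h => h.2 he)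
  · rintro ⟨M', hsub, hperf⟩
    rw [SimpleGraph.edgeSet_deleteEdges] at hsub
    exact hM.exists_augmenting_path_of_isPerfectMatching hcov hac
      ⟨hsub.trans Set.sdiff_subset, hperf⟩ he fun h => (hsub h).2 rfl
end

section
/- (Yeo's theorem) Let G be a finite edge-colored graph with no properly colored cycle. Then G has a color-separating vertex u: for each connected component C of G − u, all edges between C and u have the same color. -/
/-- The edges of the closed walk `C` are properly colored cyclically: any two
(cyclically) consecutive edges have different colors. -/
def PCCyclic {V α : Type*} {G : SimpleGraph V} (c : Sym2 V → α) {v : V}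
    (C : G.Walk v v) : Prop :=
  ∀ i : Fin C.edges.length,
    c (C.edges.get i) ≠
      c (C.edges.get ⟨(i.val + 1) % C.edges.length,
        Nat.mod_lt _ (Nat.lt_of_le_of_lt (Nat.zero_le _) i.isLt)⟩)

namespace Yeo

variable {V α : Type*} {G : SimpleGraph V} {c : Sym2 V → α}

open scoped Classical in
/-- `Seg G c u f w g S n`: there is a nontrivial path in `G` from `u` to `w` with vertex set `S`,
whose first edge has color `f` and whose last edge has color `g`, and which has `n` inner vertices
at which the two path edges have the same color. -/
inductive Seg (G : SimpleGraph V) (c : Sym2 V → α) : V → α → V → α → Set V → ℕ → Prop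
  | edge {u v : V} (h : G.Adj u v) : Seg G c u (c s(u, v)) v (c s(u, v)) {u, v} 0
  | cons {u v w : V} {f g : α} {S : Set V} {n : ℕ} (h : G.Adj u v) (hs : Seg G c v f w g S n)
      (hu : u ∉ S) :
      Seg G c u (c s(u, v)) w g (insert u S) (n + if c s(u, v) = f then 1 else 0)

variable {u v w x : V} {f f' g g' : α} {S T : Set V} {n m : ℕ}

theorem Seg.left_mem (h : Seg G c u f w g S n) : u ∈ S := by
  cases h <;> simp

theorem Seg.right_mem (h : Seg G c u f w g S n) : w ∈ S := by
  induction h <;> simp_all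

theorem Seg.ne (h : Seg G c u f w g S n) : u ≠ w := by
  cases h with
  | edge h => exact h.ne
  | cons h hs hu => rintro rfl; exact hu hs.right_mem

open scoped Classical in
theorem Seg.append (h : Seg G c u f w g S n) (h' : Seg G c w f' x g' T m)
    (hST : ∀ y ∈ S, y ∈ T → y = w) :
    Seg G c u f x g' (S ∪ T) (n + m + if g = f' then 1 else 0) := by
  induction h with
  | @edge u w h =>
    have hu : u ∉ T := fun hu => h.ne (hST u (by simp) hu)
    have hT := h'.left_mem
    have := Seg.cons h h' hu
    have e : ({u, w} : Set V) ∪ T = insert u T := by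
      ext y; simp only [Set.mem_union, Set.mem_insert_iff, Set.mem_singleton_iff]; grind
    rw [e]
    convert this using 1
    omega
  | @cons u v w f g S n h hs hu ih =>
    have huT : u ∉ T := fun huT => by
      have := hST u (by simp) huT
      subst this
      exact hu hs.right_mem
    have := Seg.cons h (ih h' fun y hy => hST y (by simp [hy])) (by simp [hu, huT])
    rw [Set.insert_union]
    convert this using 1
    omega

theorem Seg.append_of_ne (h : Seg G c u f w g S 0) (h' : Seg G c w f' x g' T 0)
    (hST : ∀ y ∈ S, y ∈ T → y = w) (hne : g ≠ f') : Seg G c u f x g' (S ∪ T) 0 := by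
  simpa [hne] using h.append h' hST

theorem Seg.reverse (h : Seg G c u f w g S n) : Seg G c w g u f S n := by
  classical
  induction h with
  | @edge u w h =>
    have := Seg.edge (c := c) h.symm
    rwa [Sym2.eq_swap, Set.pair_comm] at this
  | @cons u v w f g S n h hs hu ih =>
    have h1 := Seg.edge (c := c) h.symm
    have h2 := ih.append h1 (by simp; grind)
    have e : S ∪ {v, u} = insert u S := by
      have := hs.left_mem
      ext y; simp only [Set.mem_union, Set.mem_insert_iff, Set.mem_singleton_iff]; grind
    rw [e, Sym2.eq_swap] at h2
    convert h2 using 1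
    simp [eq_comm]

open scoped Classical in
theorem Seg.split (h : Seg G c u f w g S n) (hx : x ∈ S) (hxu : x ≠ u) (hxw : x ≠ w) :
    ∃ a b A B k l, Seg G c u f x a A k ∧ Seg G c x b w g B l ∧ A ⊆ S ∧ B ⊆ S ∧
      (∀ y ∈ A, y ∈ B → y = x) ∧ n = k + l + if a = b then 1 else 0 := by
  induction h with
  | edge h => simp at hx; grind
  | @cons u v w f g S n h hs hu ih =>
    by_cases hxv : x = v
    · subst hxv
      refine ⟨_, _, _, _, _, _, Seg.edge h, hs, ?_, ?_, ?_, by simp⟩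
      · have := hs.left_mem
        intro y; simp; grind
      · simp
      · simp; grind
    · obtain ⟨a, b, A, B, k, l, h1, h2, hA, hB, hAB, hn⟩ := ih (by simpa [hxu] using hx) hxv hxw
      refine ⟨_, _, _, _, _, _, Seg.cons h h1 fun h => hu (hA h), h2,
        Set.insert_subset_insert hA, hB.trans (by simp), ?_, by omega⟩
      intro y hy hyB
      rcases hy with rfl | hy
      · exact absurd (hB hyB) hu
      · exact hAB y hy hyB

/-- The shortest initial part of a segment that reaches the set `T` again. -/
theorem Seg.exists_first_hit (h : Seg G c u f w g S n) (hx : x ∈ S) (hxT : x ∈ T) (hxu : x ≠ u) :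
    ∃ y b A k, Seg G c u f y b A k ∧ A ⊆ S ∧ k ≤ n ∧ y ∈ T ∧ ∀ z ∈ A, z ∈ T → z = u ∨ z = y := by
  classical
  induction h with
  | @edge u w h =>
    have : x = w := by simpa [hxu] using hx
    subst this
    exact ⟨_, _, _, _, Seg.edge h, subset_rfl, le_rfl, hxT, by simp⟩
  | @cons u v w f g S n h hs hu ih =>
    by_cases hv : v ∈ T
    · refine ⟨_, _, _, _, Seg.edge h, ?_, by simp, hv, by simp⟩
      have := hs.left_mem
      intro y; simp; grind
    · obtain ⟨y, b, A, k, h1, hA, hk, hy, hz⟩ :=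
        ih (by simpa [hxu] using hx) (by rintro rfl; exact hv hxT)
      refine ⟨_, _, _, _, Seg.cons h h1 fun h => hu (hA h),
        Set.insert_subset_insert hA, by omega, hy, ?_⟩
      intro z hz1 hzT
      rcases hz1 with rfl | hz1
      · exact .inl rfl
      · rcases hz z hz1 hzT with rfl | h
        · exact absurd hzT hv
        · exact .inr h

theorem Seg.exists_walk (h : Seg G c u f w g S n) :
    ∃ p : G.Walk u w, p.IsPath ∧ (∀ x, x ∈ p.support ↔ x ∈ S) ∧
      (p.edges.map c).head? = some f ∧ (p.edges.map c).getLast? = some g ∧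
      (n = 0 → (p.edges.map c).IsChain (· ≠ ·)) ∧ (s(u, w) ∈ p.edges → f = c s(u, w)) := by
  classical
  induction h with
  | @edge u w h =>
    refine ⟨.cons h .nil, ?_⟩
    simp [h.ne]
  | @cons u v w f g S n h hs hu ih =>
    obtain ⟨p, hp, hS, hf, hg, hc, -⟩ := ih
    refine ⟨.cons h p, ?_, ?_, by simp, ?_, ?_, ?_⟩
    · simp [hp, hS, hu]
    · simp [hS]
    · simp [List.getLast?_cons, hg]
    · intro hn
      simp only [Nat.add_eq_zero_iff, ite_eq_right_iff, one_ne_zero, imp_false] at hn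
      rw [SimpleGraph.Walk.edges_cons, List.map_cons, List.isChain_cons]
      refine ⟨?_, hc hn.1⟩
      intro y hy
      rw [hf] at hy
      cases hy
      exact hn.2
    · simp only [SimpleGraph.Walk.edges_cons, List.mem_cons]
      rintro (h | h)
      · rw [h]
      · exact absurd ((hS u).1 (p.fst_mem_support_of_mem_edges h)) hu

theorem exists_seg_of_isPath (p : G.Walk u w) (hp : p.IsPath) (hne : u ≠ w) :
    ∃ f g n, Seg G c u f w g {x | x ∈ p.support} n := by
  classical
  induction p with
  | nil => exact absurd rfl hne
  | @cons u v w h p ih =>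
    rw [SimpleGraph.Walk.cons_isPath_iff] at hp
    by_cases hvw : v = w
    · subst hvw
      have : p = .nil := by simpa using hp.1
      subst this
      refine ⟨c s(u, v), c s(u, v), 0, ?_⟩
      convert Seg.edge (c := c) h using 1
      ext; simp
    · obtain ⟨f, g, n, hs⟩ := ih hp.1 hvw
      refine ⟨c s(u, v), g, n + if c s(u, v) = f then 1 else 0, ?_⟩
      convert Seg.cons h hs hp.2 using 1
      ext; simp

theorem pcCyclic_of_isChain (C : G.Walk v v) (hc : (C.edges.map c).IsChain (· ≠ ·))
    (hl : ∀ a ∈ (C.edges.map c).getLast?, ∀ b ∈ (C.edges.map c).head?, a ≠ b) :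
    PCCyclic c C := by
  rintro ⟨i, hi⟩
  rw [List.isChain_iff_getElem] at hc
  by_cases h : i + 1 < C.edges.length
  · have := hc i (by simpa using h)
    simpa only [List.get_eq_getElem, Nat.mod_eq_of_lt h, List.getElem_map] using this
  · have hi' : i + 1 = C.edges.length := by omega
    have e : i = C.edges.length - 1 := by omega
    apply hl
    · rw [List.getLast?_eq_getElem?]
      simp [e]
      grind
    · rw [List.head?_eq_getElem?]
      simp [hi']
      grind

/-- The graph has no properly colored cycle. -/
abbrev NoPCCycle (G : SimpleGraph V) (c : Sym2 V → α) : Prop :=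
  ¬ ∃ (v : V) (C : G.Walk v v), C.IsCycle ∧ PCCyclic c C

theorem NoPCCycle.not_seg_adj (hnc : NoPCCycle G c) (h : G.Adj u v) (h' : Seg G c v f u g S 0)
    (hf : c s(u, v) ≠ f) (hg : g ≠ c s(u, v)) : False := by
  obtain ⟨p, hp, -, h1, h2, h3, h4⟩ := h'.exists_walk
  refine hnc ⟨u, .cons h p, ?_, pcCyclic_of_isChain _ ?_ ?_⟩
  · rw [SimpleGraph.Walk.cons_isCycle_iff]
    refine ⟨hp, fun he => hf ?_⟩
    rw [Sym2.eq_swap] at he ⊢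
    exact (h4 he).symm
  · rw [SimpleGraph.Walk.edges_cons, List.map_cons, List.isChain_cons]
    refine ⟨?_, h3 rfl⟩
    intro y hy
    rw [h1] at hy
    cases hy
    exact hf
  · simpa [List.getLast?_cons, h2] using hg

theorem NoPCCycle.not_seg_seg (hnc : NoPCCycle G c) (h : Seg G c u f w g S 0)
    (h' : Seg G c w f' u g' T 0) (hST : ∀ y ∈ S, y ∈ T → y = u ∨ y = w)
    (hw : g ≠ f') (hu : g' ≠ f) : False := by
  classical
  generalize hn : 0 = n at h
  cases h with
  | edge h => exact hnc.not_seg_adj h h' hw hu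
  | @cons u v w f g S n h hs huS =>
    have hn' : n = 0 ∧ c s(u, v) ≠ f := by
      constructor
      · omega
      · intro h; simp [h] at hn
    obtain ⟨rfl, hf⟩ := hn'
    refine hnc.not_seg_adj h (hs.append_of_ne h' ?_ hw) hf hu
    intro y hy hyT
    rcases hST y (by simp [hy]) hyT with rfl | h
    · exact absurd hy huS
    · exact h

/-- A cycle through `u` can be cut at `u` and at the first vertex where it is not properly
colored. -/
theorem NoPCCycle.exists_cusp (hnc : NoPCCycle G c) (hp : Seg G c u f v g S 0)
    (hr : Seg G c v f' u g' T n) (hST : ∀ y ∈ S, y ∈ T → y = u ∨ y = v) (hu : f ≠ g')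
    (hn : g = f' → n < m) (hn' : n ≤ m) :
    ∃ w a A B k, Seg G c u f w a A 0 ∧ Seg G c w a u g' B k ∧ (∀ y ∈ A, y ∈ B → y = u ∨ y = w) ∧
      k < m := by
  classical
  generalize hu' : u = u' at hr
  induction hr generalizing g S with
  | @edge v u' h =>
    subst hu'
    by_cases hg : g = c s(v, u)
    · subst hg
      exact ⟨_, _, _, _, _, hp, .edge h, hST, hn rfl⟩
    · exact (hnc.not_seg_seg hp (.edge h) hST hg hu.symm).elim
  | @cons v x u' f1 g' T n h hs hv ih =>
    subst hu'
    by_cases hg : g = c s(v, x)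
    · subst hg
      exact ⟨_, _, _, _, _, hp, .cons h hs hv, hST, hn rfl⟩
    · by_cases hxu : x = u
      · exact absurd hxu hs.ne
      have hxS : x ∉ S := fun hx => by
        rcases hST x hx (by simp [hs.left_mem]) with h' | h'
        · exact hxu h'
        · exact h.ne h'.symm
      have hp' := hp.append_of_ne (.edge h) (by simp; grind) hg
      refine ih hp' ?_ hu ?_ (by omega) rfl
      · intro y hy hyT
        simp only [Set.mem_union, Set.mem_insert_iff, Set.mem_singleton_iff] at hy
        have := hST y
        simp only [Set.mem_insert_iff] at this
        grind
      · intro e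
        rw [if_pos e] at hn'
        omega

theorem NoPCCycle.exists_cusp_reverse (hnc : NoPCCycle G c) (hp : Seg G c u f v g S 0)
    (hr : Seg G c v f' u g' T n) (hST : ∀ y ∈ S, y ∈ T → y = u ∨ y = v) (hu : f ≠ g')
    (hn : g = f' → n < m) (hn' : n ≤ m) :
    ∃ w a A B k, Seg G c u g' w a A 0 ∧ Seg G c w a u f B k ∧ (∀ y ∈ A, y ∈ B → y = u ∨ y = w) ∧
      k < m := by
  classical
  have hr' := hr.reverse
  cases hr' with
  | edge h =>
    refine hnc.exists_cusp (.edge h) hp.reverse ?_ hu.symm (fun e => ?_) (Nat.zero_le _)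
    · simp
    · have := hn e.symm
      omega
  | @cons _ x _ _ f1 T n h hs hx =>
    have h2 := hs.append hp.reverse (by
      intro y hy hyS
      rcases hST y hyS (by simp [hy]) with rfl | h'
      · exact absurd hy hx
      · exact h')
    refine hnc.exists_cusp (.edge h) h2 ?_ hu.symm (fun e => ?_) ?_
    · simp
    · rw [if_pos e] at hn hn'
      split_ifs with e'
      · have := hn e'.symm
        omega
      · omega
    · rw [add_zero]
      by_cases e' : f' = g
      · have := hn e'.symm
        rw [if_pos e']
        omega
      · rw [if_neg e']
        omega

/-- From a cycle through `u` whose edges at `u` have different colors one finds a properly colored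
path from `u` to which no properly colored path continuing it returns. -/
theorem NoPCCycle.exists_no_return (hnc : NoPCCycle G c) {F : α → Prop}
    (hF : ∀ a b, a ≠ b → F a ∨ F b) (hp : Seg G c u f v g S 0)
    (hr : Seg G c v f' u g' T n) (hST : ∀ y ∈ S, y ∈ T → y = u ∨ y = v) (hu : f ≠ g')
    (hn : g = f' → n < m) (hn' : n ≤ m) :
    ∃ a w b P, Seg G c u a w b P 0 ∧ F a ∧
      ∀ d z e Q, Seg G c w d z e Q 0 → d ≠ b → ∀ t ∈ Q, t ∈ P → t = w := by
  classical
  induction m using Nat.strong_induction_on generalizing v f g f' g' S T n with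
  | _ m ih =>
  obtain ⟨f, g', w, b, P, R, n, hu, hFf, hp, hr, hPR, hn⟩ : ∃ f g' w b P R n, f ≠ g' ∧ F f ∧
      Seg G c u f w b P 0 ∧ Seg G c w b u g' R n ∧ (∀ y ∈ P, y ∈ R → y = u ∨ y = w) ∧ n < m := by
    rcases hF _ _ hu with h | h
    · obtain ⟨w, a, A, B, k, h1, h2, h3, h4⟩ := hnc.exists_cusp hp hr hST hu hn hn'
      exact ⟨_, _, _, _, _, _, _, hu, h, h1, h2, h3, h4⟩
    · obtain ⟨w, a, A, B, k, h1, h2, h3, h4⟩ := hnc.exists_cusp_reverse hp hr hST hu hn hn'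
      exact ⟨_, _, _, _, _, _, _, hu.symm, h, h1, h2, h3, h4⟩
  by_contra! hcon
  obtain ⟨d, z, e, Q, hq, hd, t, htQ, htP, htw⟩ := hcon f w b P hp hFf
  obtain ⟨y, e, Q, k, hq, -, hk, hyT, hQ⟩ :=
    hq.exists_first_hit (T := P ∪ R) htQ (.inl htP) htw
  obtain rfl : k = 0 := by omega
  have hyw := hq.ne
  have hQP : ∀ z ∈ Q, z ∈ P → z = w ∨ z = y := fun z hz hz' => hQ z hz (.inl hz')
  have hQR : ∀ z ∈ Q, z ∈ R → z = w ∨ z = y := fun z hz hz' => hQ z hz (.inr hz')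
  have no_better_cycle : ∀ {a w b c' d P R k}, a ≠ d → Seg G c u a w b P 0 → Seg G c w c' u d R k →
      (∀ y ∈ P, y ∈ R → y = u ∨ y = w) → k + (if b = c' then 1 else 0) < m → False := by
    intro a w b c' d P R k h1 h2 h3 h4 h5
    obtain ⟨a, w, b, P, h6, h7, h8⟩ := ih _ h5 h2 h3 h4 h1 (fun h => by simp [h]) (by omega)
    obtain ⟨d, z, e, Q, h9, h10, t, h11, h12, h13⟩ := hcon a w b P h6 h7
    exact h13 (h8 d z e Q h9 h10 t h11 h12)
  by_cases hyu : y = u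
  · subst hyu
    by_cases he : e = f
    · subst he
      exact no_better_cycle hu hq.reverse hr (fun z hz hz' => (hQR z hz hz').symm)
        (by simpa [hd] using hn)
    · exact hnc.not_seg_seg hp hq (fun z hz hz' => (hQP z hz' hz).symm) hd.symm he
  by_cases hyP : y ∈ P
  · have hyR : y ∉ R := fun h => by rcases hPR y hyP h with h | h <;> grind
    obtain ⟨a, a', P₁, P₂, k, l, h1, h2, hP₁, hP₂, h12, hkl⟩ := hp.split hyP hyu hyw.symm
    obtain ⟨rfl, rfl, haa⟩ : k = 0 ∧ l = 0 ∧ a ≠ a' := by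
      split_ifs at hkl with h
      exact ⟨by omega, by omega, h⟩
    have hwP₁ : w ∉ P₁ := fun h => hyw (h12 w h h2.right_mem)
    by_cases he : e = a'
    · subst he
      refine no_better_cycle hu (h1.append_of_ne hq.reverse ?_ haa) hr ?_ (by simpa [hd] using hn)
      · intro z hz hzQ
        rcases hQP z hzQ (hP₁ hz) with rfl | h
        · exact absurd hz hwP₁
        · exact h
      · rintro z (hz | hz) hzR
        · exact hPR z (hP₁ hz) hzR
        · rcases hQR z hz hzR with h | rfl
          · exact .inr h
          · exact absurd hzR hyR
    · exact hnc.not_seg_seg h2 hq (fun z hz hzQ => (hQP z hzQ (hP₂ hz)).symm) hd.symm he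
  · have hyR : y ∈ R := hyT.resolve_left hyP
    obtain ⟨a, a', R₁, R₂, k, l, h1, h2, hR₁, hR₂, h12, hkl⟩ := hr.split hyR hyw.symm hyu
    have hwR₂ : w ∉ R₂ := fun h => hyw (h12 w h1.left_mem h)
    have hpq : ¬ l + (if e = a' then 1 else 0) < m := by
      refine no_better_cycle hu (hp.append_of_ne hq ?_ hd.symm) h2 ?_
      · intro z hz hzQ
        rcases hQP z hzQ hz with h | rfl
        · exact h
        · exact absurd hz hyP
      · rintro z (hz | hz) hzR
        · rcases hPR z hz (hR₂ hzR) with h | rfl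
          · exact .inl h
          · exact absurd hzR hwR₂
        · rcases hQR z hz (hR₂ hzR) with rfl | h
          · exact absurd hzR hwR₂
          · exact .inr h
    obtain ⟨he, rfl, haa⟩ : e = a' ∧ k = 0 ∧ a ≠ a' := by
      split_ifs at hkl hpq <;> first | omega | exact ⟨by assumption, by omega, by assumption⟩
    subst he
    exact hnc.not_seg_seg hq h1.reverse (fun z hz hzR => hQR z hz (hR₁ hzR)) haa.symm hd.symm

theorem NoPCCycle.exists_no_return_of_reachable (hnc : NoPCCycle G c) {F : α → Prop}
    (hF : ∀ a b, a ≠ b → F a ∨ F b) (hv : G.Adj u v) (hw : G.Adj u w)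
    (hvw : (G.induce {x | x ≠ u}).Reachable ⟨v, hv.ne'⟩ ⟨w, hw.ne'⟩)
    (hne : c s(u, v) ≠ c s(u, w)) :
    ∃ a w b P, Seg G c u a w b P 0 ∧ F a ∧
      ∀ d z e Q, Seg G c w d z e Q 0 → d ≠ b → ∀ t ∈ Q, t ∈ P → t = w := by
  classical
  obtain ⟨p, hp⟩ := hvw.exists_isPath
  let i := SimpleGraph.Embedding.induce (G := G) {x | x ≠ u}
  have hp' : (p.map i.toHom).IsPath := hp.map i.injective
  obtain ⟨f, g, n, h⟩ := exists_seg_of_isPath (c := c) (p.map i.toHom) hp' (by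
    rintro h
    have : v = w := h
    exact hne (by rw [this]))
  have hu : u ∉ {x | x ∈ (p.map i.toHom).support} := by
    simp only [SimpleGraph.Walk.support_map, Set.mem_ofPred_eq, List.mem_map, not_exists, not_and]
    exact fun x _ => x.2
  generalize {x | x ∈ (p.map i.toHom).support} = S at h hu
  change Seg G c v f w g S n at h
  have hr := h.append (.edge hw.symm) (by simp; grind)
  refine hnc.exists_no_return hF (.edge hv) hr (by simp) ?_ (fun _ => Nat.lt_succ_self _)
    (Nat.le_succ _)
  rwa [Sym2.eq_swap (a := w)]

end Yeo

/-- Yeo's theorem: a finite edge-colored graph with no properly colored cycle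
has a color-separating vertex `u`: for each connected component of `G − u`, all
edges from `u` to that component have the same color. -/
theorem stmt10 {V α : Type*} [Fintype V] [Nonempty V] (G : SimpleGraph V)
    (c : Sym2 V → α)
    (hnc : ¬ ∃ (v : V) (C : G.Walk v v), C.IsCycle ∧ PCCyclic c C) :
    ∃ u : V, ∀ v w : V, ∀ (hv : G.Adj u v) (hw : G.Adj u w),
      (G.induce {x | x ≠ u}).Reachable ⟨v, hv.ne'⟩ ⟨w, hw.ne'⟩ →
      c s(u, v) = c s(u, w) := by
  by_contra! hcon
  obtain ⟨u₀⟩ := ‹Nonempty V›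
  have key : ∀ k : ℕ, ∃ (u : V) (F : α → Prop) (P : Set V), (∀ a b, a ≠ b → F a ∨ F b) ∧
      k < P.ncard ∧ u ∈ P ∧
      ∀ d z e Q, Yeo.Seg G c u d z e Q 0 → F d → ∀ t ∈ Q, t ∈ P → t = u := by
    intro k
    induction k with
    | zero => exact ⟨u₀, fun _ => True, {u₀}, by simp, by simp, by simp, by simp⟩
    | succ k ih =>
      obtain ⟨u, F, P, hF, hk, hu, hP⟩ := ih
      obtain ⟨v, w, hv, hw, hvw, hne⟩ := hcon u
      obtain ⟨a, x, b, P', hs, ha, hP'⟩ :=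
        Yeo.NoPCCycle.exists_no_return_of_reachable hnc hF hv hw hvw hne
      have hxP : x ∉ P := fun h => hs.ne (hP _ _ _ _ hs ha x hs.right_mem h).symm
      refine ⟨x, (· ≠ b), P ∪ P', by grind, ?_, .inr hs.right_mem, ?_⟩
      · refine lt_of_le_of_lt hk (Set.ncard_lt_ncard ?_ (Set.toFinite _))
        exact Set.ssubset_iff_subset_ne.2 ⟨Set.subset_union_left,
          fun h => hxP (h ▸ .inr hs.right_mem)⟩
      · rintro d z e Q hq hd t htQ (ht | ht)
        · have hsq := hs.append_of_ne hq (fun y hy hyQ => hP' _ _ _ _ hq hd y hyQ hy) hd.symm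
          obtain rfl := hP _ _ _ _ hsq ha t (.inr htQ) ht
          exact hP' _ _ _ _ hq hd _ htQ hs.left_mem
        · exact hP' _ _ _ _ hq hd t htQ ht
  obtain ⟨u, F, P, -, hk, -⟩ := key (Nat.card V)
  exact absurd (Set.ncard_le_card P) (by omega)
end

section
/- Let G be a graph with a transition system T. Compatible cycles (cycles avoiding forbidden transitions) in (G,T) correspond bijectively to rainbow cycles in the edge-colored line graph L_EC(G,T), and compatible closed trails correspond bijectively to properly colored cycles in L_EC(G,T). -/
/-- The consecutive edges of the closed walk `C` (cyclically, including the
pair formed by the last and first edge) are allowed transitions: each pair of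
consecutive edges is adjacent in the transition graph `T v` of their common
vertex `v`. -/
def CyclicCompatible {V : Type*} {G : SimpleGraph V}
    (T : V → Sym2 V → Sym2 V → Prop) {v : V} (C : G.Walk v v) : Prop :=
  List.Chain' (fun d₁ d₂ : G.Dart => T d₁.toProd.2 d₁.edge d₂.edge) C.darts ∧
  ∀ d ∈ C.darts.getLast?, ∀ d' ∈ C.darts.head?, T v d.edge d'.edge

/-- A cycle of the edge-colored line graph `L_EC(G,T)`, encoded as a cyclic
list of pairs (vertex of `L_EC`, i.e. edge of `G`; color of the following
`L_EC`-edge, i.e. vertex of `G`): the `G`-edges are pairwise distinct and each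
consecutive pair of them is joined in `L_EC` by an edge of the recorded color. -/
def IsLECCycle {V : Type*} (T : V → Sym2 V → Sym2 V → Prop)
    (L : List (Sym2 V × V)) : Prop :=
  2 ≤ L.length ∧ (L.map Prod.fst).Nodup ∧
  ∀ i : Fin L.length,
    T (L.get i).2 (L.get i).1
      (L.get ⟨(i.val + 1) % L.length,
        Nat.mod_lt _ (Nat.lt_of_le_of_lt (Nat.zero_le _) i.isLt)⟩).1

/-- A relation holds between all cyclically consecutive elements of a list iff it holds along the
list and from the last element to the first one. -/
theorem List.isChain_and_getLast_head_iff {α : Type*} (R : α → α → Prop) (l : List α) :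
    (l.IsChain R ∧ ∀ a ∈ l.getLast?, ∀ b ∈ l.head?, R a b) ↔
      ∀ (i : ℕ) (h : i < l.length), R l[i] (l[(i + 1) % l.length]'(Nat.mod_lt _ (by omega))) := by
  rw [List.isChain_iff_getElem]
  constructor
  · rintro ⟨hc, hl⟩ i h
    rcases Nat.lt_or_ge (i + 1) l.length with h' | h'
    · simpa only [Nat.mod_eq_of_lt h'] using hc i h'
    · obtain rfl : i = l.length - 1 := by omega
      have e : (l.length - 1 + 1) % l.length = 0 := by
        rw [Nat.sub_add_cancel (by omega), Nat.mod_self]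
      simp only [e]
      refine hl _ ?_ _ ?_
      · simp [List.getLast?_eq_getElem?]
      · simp [List.head?_eq_getElem?]
  · refine fun H => ⟨fun i h => ?_, fun a ha b hb => ?_⟩
    · simpa only [Nat.mod_eq_of_lt h] using H i (by omega)
    · rw [Option.mem_def, List.getLast?_eq_getElem?, List.getElem?_eq_some_iff] at ha
      rw [Option.mem_def, List.head?_eq_getElem?, List.getElem?_eq_some_iff] at hb
      obtain ⟨h, rfl⟩ := ha
      obtain ⟨h', rfl⟩ := hb
      have e : (l.length - 1 + 1) % l.length = 0 := by
        rw [Nat.sub_add_cancel (by omega), Nat.mod_self]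
      simpa only [e] using H _ h

namespace SimpleGraph.Walk

variable {V : Type*} {G : SimpleGraph V}

/-- The edges of a walk, each paired with the vertex at which the walk leaves it. -/
def edgeTargets {u v : V} (p : G.Walk u v) : List (Sym2 V × V) :=
  p.darts.map fun d => (d.edge, d.snd)

theorem edgeTargets_map_fst {u v : V} (p : G.Walk u v) : p.edgeTargets.map Prod.fst = p.edges := by
  simp [edgeTargets, edges_eq_map_darts]

theorem edgeTargets_map_snd {u v : V} (p : G.Walk u v) :
    p.edgeTargets.map Prod.snd = p.support.tail := by
  simp [edgeTargets, ← map_snd_darts]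

@[simp]
theorem length_edgeTargets {u v : V} (p : G.Walk u v) : p.edgeTargets.length = p.length := by
  simp [edgeTargets]

@[simp]
theorem edgeTargets_eq_nil {u v : V} {p : G.Walk u v} : p.edgeTargets = [] ↔ p.Nil := by
  rw [← List.length_eq_zero_iff, length_edgeTargets, length_eq_zero_iff]

theorem getElem_edgeTargets {u v : V} (p : G.Walk u v) {i : ℕ} (h : i < p.edgeTargets.length) :
    p.edgeTargets[i] = (s(p.getVert i, p.getVert (i + 1)), p.getVert (i + 1)) := by
  simp [edgeTargets, darts_getElem_eq_getVert, Dart.edge]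

theorem getLast_edgeTargets_snd {u v : V} (p : G.Walk u v) (h : p.edgeTargets ≠ []) :
    (p.edgeTargets.getLast h).2 = v := by
  have h0 : 0 < p.edgeTargets.length := List.length_pos_iff.mpr h
  rw [List.getLast_eq_getElem, getElem_edgeTargets, Nat.sub_add_cancel h0, length_edgeTargets,
    getVert_length]

/-- A closed walk with at least one edge is determined, including its base point, by its edges
and their targets. -/
theorem sigma_ext_edgeTargets {p q : Σ v : V, G.Walk v v} (hp : ¬p.2.Nil)
    (h : p.2.edgeTargets = q.2.edgeTargets) : p = q := by
  obtain ⟨u, p⟩ := p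
  obtain ⟨v, q⟩ := q
  dsimp only at hp h
  have hp' : p.edgeTargets ≠ [] := by simpa using hp
  obtain rfl : u = v := by
    rw [← getLast_edgeTargets_snd p hp', ← getLast_edgeTargets_snd q (h ▸ hp')]
    simp only [h]
  have : p = q := by
    apply ext_support
    rw [← cons_tail_support p, ← cons_tail_support q, ← edgeTargets_map_snd, h,
      edgeTargets_map_snd]
  rw [this]

/-- A list of edges with targets in which every edge joins the preceding target to its own is
traced by a walk. -/
theorem exists_edgeTargets_eq (L : List (Sym2 V × V)) (a : Sym2 V × V)
    (h : (a :: L).IsChain fun x y => G.Adj x.2 y.2 ∧ y.1 = s(x.2, y.2)) :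
    ∃ p : G.Walk a.2 ((a :: L).getLast (List.cons_ne_nil a L)).2, p.edgeTargets = L := by
  induction L generalizing a with
  | nil => exact ⟨nil, rfl⟩
  | cons b L ih =>
    rw [List.isChain_cons_cons] at h
    obtain ⟨p, hp⟩ := ih b h.2
    rw [List.getLast_cons (List.cons_ne_nil b L)]
    refine ⟨cons h.1.1 p, ?_⟩
    rw [edgeTargets, darts_cons, List.map_cons, ← edgeTargets, hp]
    exact congrArg (· :: L) (Prod.ext h.1.2.symm rfl)

/-- A closed version of `exists_edgeTargets_eq`. -/
theorem exists_closed_edgeTargets_eq (L : List (Sym2 V × V)) (hL : L ≠ [])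
    (h : ∀ (i : ℕ) (hi : i < L.length),
      G.Adj L[i].2 (L[(i + 1) % L.length]'(Nat.mod_lt _ (by omega))).2 ∧
        (L[(i + 1) % L.length]'(Nat.mod_lt _ (by omega))).1 =
          s(L[i].2, (L[(i + 1) % L.length]'(Nat.mod_lt _ (by omega))).2)) :
    ∃ p : Σ v : V, G.Walk v v, p.2.edgeTargets = L := by
  obtain ⟨hc, hl⟩ := (List.isChain_and_getLast_head_iff
    (fun x y : Sym2 V × V => G.Adj x.2 y.2 ∧ y.1 = s(x.2, y.2)) L).mpr h
  obtain ⟨p, hp⟩ := exists_edgeTargets_eq L (L.getLast hL)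
    (List.isChain_cons.mpr ⟨fun b hb => hl _ (List.getLast?_eq_some_getLast hL) b hb, hc⟩)
  exact ⟨⟨_, p.copy rfl (by rw [List.getLast_cons hL])⟩, by
    simpa [edgeTargets] using hp⟩

theorem edgeTargets_snd_ne_of_closed {v : V} (p : G.Walk v v) (i : ℕ)
    (h : i < p.edgeTargets.length) :
    p.edgeTargets[i].2 ≠
      (p.edgeTargets[(i + 1) % p.edgeTargets.length]'(Nat.mod_lt _ (by omega))).2 := by
  rw [getElem_edgeTargets, getElem_edgeTargets]
  rw [length_edgeTargets] at h
  simp only [length_edgeTargets]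
  rcases Nat.lt_or_ge (i + 1) p.length with h' | h'
  · rw [Nat.mod_eq_of_lt h']
    exact (p.adj_getVert_succ h').ne
  · have e : i + 1 = p.length := by omega
    rw [e, Nat.mod_self, getVert_length]
    have := (p.adj_getVert_succ (i := 0) (by omega)).ne
    rwa [getVert_zero] at this

theorem cyclicCompatible_iff_edgeTargets (T : V → Sym2 V → Sym2 V → Prop) {v : V}
    (p : G.Walk v v) :
    CyclicCompatible T p ↔ ∀ (i : ℕ) (h : i < p.edgeTargets.length),
      T p.edgeTargets[i].2 p.edgeTargets[i].1
        (p.edgeTargets[(i + 1) % p.edgeTargets.length]'(Nat.mod_lt _ (by omega))).1 := by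
  rw [← List.isChain_and_getLast_head_iff (fun x y : Sym2 V × V => T x.2 x.1 y.1)]
  rw [CyclicCompatible, List.Chain']
  refine and_congr (by rw [edgeTargets, List.isChain_map]) ?_
  have hlast : ∀ d ∈ p.darts.getLast?, d.snd = v := by
    intro d hd
    have hne : p.edgeTargets ≠ [] := by
      rw [edgeTargets, ne_eq, List.map_eq_nil_iff]
      intro h
      simp [h] at hd
    have := p.getLast_edgeTargets_snd hne
    simp only [edgeTargets, List.getLast_map] at this
    rwa [List.getLast_of_mem_getLast? hd] at this
  simp only [edgeTargets, List.getLast?_map, List.head?_map, Option.mem_def, Option.map_eq_some_iff,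
    forall_exists_index, and_imp, forall_apply_eq_imp_iff₂]
  exact forall₂_congr fun d hd => by rw [hlast d hd]

theorem isLECCycle_edgeTargets_iff (T : V → Sym2 V → Sym2 V → Prop) {v : V} {p : G.Walk v v}
    (hp : ¬p.Nil) :
    IsLECCycle T p.edgeTargets ↔ p.IsCircuit ∧ CyclicCompatible T p := by
  rw [cyclicCompatible_iff_edgeTargets, IsLECCycle, edgeTargets_map_fst, ← isTrail_def,
    Fin.forall_iff, ← and_assoc]
  refine and_congr ⟨fun h => ⟨h.2, by rintro rfl; exact hp nil_nil⟩, fun h => ⟨?_, h.isTrail⟩⟩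
    Iff.rfl
  rw [length_edgeTargets]
  exact le_trans (by norm_num) h.three_le_length

end SimpleGraph.Walk

section

variable {V : Type*} {G : SimpleGraph V} {T : V → Sym2 V → Sym2 V → Prop}

/-- Every properly colored cycle of the edge-colored line graph is traced by a compatible closed
trail. -/
theorem IsLECCycle.exists_edgeTargets_eq
    (hinc : ∀ v e f, T v e f → e ∈ G.edgeSet ∧ f ∈ G.edgeSet ∧ v ∈ e ∧ v ∈ f ∧ e ≠ f)
    {L : List (Sym2 V × V)} (hL : IsLECCycle T L)
    (hne : ∀ (i : ℕ) (h : i < L.length),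
      L[i].2 ≠ (L[(i + 1) % L.length]'(Nat.mod_lt _ (by omega))).2) :
    ∃ p : Σ v : V, G.Walk v v, (p.2.IsCircuit ∧ CyclicCompatible T p.2) ∧ p.2.edgeTargets = L := by
  obtain ⟨hlen, -, hT⟩ := id hL
  have hL0 : L ≠ [] := by rintro rfl; simp at hlen
  obtain ⟨p, rfl⟩ := SimpleGraph.Walk.exists_closed_edgeTargets_eq (G := G) L hL0 fun i hi => by
    have hj : (i + 1) % L.length < L.length := Nat.mod_lt _ (by omega)
    obtain ⟨-, hf, -, hvf, -⟩ := hinc _ _ _ (hT ⟨i, hi⟩)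
    obtain ⟨-, -, hwf, -, -⟩ := hinc _ _ _ (hT ⟨_, hj⟩)
    have e := (Sym2.mem_and_mem_iff (hne i hi)).mp ⟨hvf, hwf⟩
    refine ⟨?_, e⟩
    rw [← SimpleGraph.mem_edgeSet, ← e]
    exact hf
  exact ⟨p, (SimpleGraph.Walk.isLECCycle_edgeTargets_iff T (by simpa using hL0)).mp hL, rfl⟩

/-- Rainbow cycles are properly colored: cyclically consecutive colors of a list of length at
least two without repeated colors differ. -/
theorem IsLECCycle.snd_ne_of_nodup {L : List (Sym2 V × V)} (hL : IsLECCycle T L)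
    (h : (L.map Prod.snd).Nodup) (i : ℕ) (hi : i < L.length) :
    L[i].2 ≠ (L[(i + 1) % L.length]'(Nat.mod_lt _ (by omega))).2 := by
  intro he
  have hlen := hL.1
  have hij : i = (i + 1) % L.length :=
    (h.getElem_inj_iff (i := i) (j := (i + 1) % L.length)
      (hi := by simpa using hi) (hj := by simpa using Nat.mod_lt _ (by omega))).mp
        (by simpa using he)
  rcases Nat.lt_or_ge (i + 1) L.length with h' | h'
  · rw [Nat.mod_eq_of_lt h'] at hij
    omega
  · rw [show i + 1 = L.length by omega, Nat.mod_self] at hij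
    omega

end

/-- Compatible cycles of `(G,T)` correspond bijectively to rainbow cycles of
the edge-colored line graph `L_EC(G,T)`, and compatible closed trails
correspond bijectively to properly colored cycles of `L_EC(G,T)`. -/
theorem stmt13 {V : Type*} [Fintype V] (G : SimpleGraph V)
    (T : V → Sym2 V → Sym2 V → Prop)
    (hsymm : ∀ v e f, T v e f → T v f e)
    (hinc : ∀ v e f, T v e f →
      e ∈ G.edgeSet ∧ f ∈ G.edgeSet ∧ v ∈ e ∧ v ∈ f ∧ e ≠ f) :
    Nonempty
      ({p : Σ v : V, G.Walk v v // p.2.IsCycle ∧ CyclicCompatible T p.2} ≃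
        {L : List (Sym2 V × V) // IsLECCycle T L ∧ (L.map Prod.snd).Nodup}) ∧
    Nonempty
      ({p : Σ v : V, G.Walk v v // p.2.IsCircuit ∧ CyclicCompatible T p.2} ≃
        {L : List (Sym2 V × V) // IsLECCycle T L ∧
          ∀ i : Fin L.length, (L.get i).2 ≠
            (L.get ⟨(i.val + 1) % L.length,
              Nat.mod_lt _ (Nat.lt_of_le_of_lt (Nat.zero_le _) i.isLt)⟩).2}) := by
  constructor
  · refine ⟨Equiv.ofBijective (fun p => ⟨p.1.2.edgeTargets,
      (SimpleGraph.Walk.isLECCycle_edgeTargets_iff T p.2.1.not_nil).mpr ⟨p.2.1.isCircuit, p.2.2⟩,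
      p.1.2.edgeTargets_map_snd ▸ p.2.1.support_nodup⟩) ⟨fun p q h => ?_, fun L => ?_⟩⟩
    · exact Subtype.ext (SimpleGraph.Walk.sigma_ext_edgeTargets p.2.1.not_nil
        (congrArg Subtype.val h))
    · obtain ⟨L, hL, hn⟩ := L
      obtain ⟨p, ⟨hc, hT⟩, rfl⟩ := hL.exists_edgeTargets_eq hinc (hL.snd_ne_of_nodup hn)
      exact ⟨⟨p, ⟨hc, p.2.edgeTargets_map_snd ▸ hn⟩, hT⟩, rfl⟩
  · refine ⟨Equiv.ofBijective (fun p => ⟨p.1.2.edgeTargets,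
      (SimpleGraph.Walk.isLECCycle_edgeTargets_iff T p.2.1.not_nil).mpr p.2,
      fun i => p.1.2.edgeTargets_snd_ne_of_closed i i.2⟩) ⟨fun p q h => ?_, fun L => ?_⟩⟩
    · exact Subtype.ext (SimpleGraph.Walk.sigma_ext_edgeTargets p.2.1.not_nil
        (congrArg Subtype.val h))
    · obtain ⟨L, hL, hn⟩ := L
      obtain ⟨p, hp, rfl⟩ := hL.exists_edgeTargets_eq hinc fun i hi => hn ⟨i, hi⟩
      exact ⟨⟨p, hp⟩, rfl⟩
end

section
/- Let G be a finite graph with at least one edge whose edge coloring is a multipartite decomposition (every color class is a complete multipartite graph), and suppose G has no rainbow cycle. Then there exists a color class H with vertex partition U_1,…,U_k such that removing the edges of H disconnects the parts: for all v ∈ U_i and w ∈ U_j with i ≠ j, v and w lie in different connected components of G − E(H). -/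
universe u v

theorem List.nodup_append_cons_reverse_append {α : Type*} {l₁ l₂ m : List α} {b c : α}
    (hl : (l₁ ++ c :: l₂).Nodup) (hb : b ∉ l₁ ++ c :: l₂) (hm : m.Nodup) (hbm : b ∉ m)
    (hcm : c ∉ m) (hdisj : ∀ j ∈ l₁, j ∉ m) : (l₁ ++ c :: (m.reverse ++ [b])).Nodup := by
  simp only [List.nodup_append, List.nodup_cons, List.mem_append, List.mem_cons,
    List.nodup_reverse, List.mem_reverse, not_or] at *
  grind

/-- `ColorWalk E x l y`: there is a walk from `x` to `y` whose successive edges have the colors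
listed in `l`, where `E a` is the adjacency relation of color `a`. -/
inductive ColorWalk {V : Type u} {α : Type v} (E : α → V → V → Prop) : V → List α → V → Prop
  | nil (x : V) : ColorWalk E x [] x
  | cons {x y z : V} {a : α} {l : List α} :
      E a x y → ColorWalk E y l z → ColorWalk E x (a :: l) z

/-- A multigraph whose edges are colored so that every color class is complete multipartite and
every closed walk with pairwise distinct colors is trivial. -/
structure IsRainbowFree {V : Type u} {α : Type v} (E : α → V → V → Prop) : Prop where
  symm : ∀ {a x y}, E a x y → E a y x
  multipartite : ∀ {a x y z w}, E a x y → E a z w → E a x z ∨ E a z y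
  acyclic : ∀ {x l}, ColorWalk E x l x → l.Nodup → l = []

/-- Removing the edges of color `a` disconnects the ends of each of these edges. -/
def Separates {V : Type u} {α : Type v} (E : α → V → V → Prop) (a : α) : Prop :=
  ∀ x y, E a x y → ¬ Relation.EqvGen (fun p q => ∃ j, j ≠ a ∧ E j p q) x y

namespace ColorWalk

variable {V : Type u} {α : Type v} {E : α → V → V → Prop} {x y z : V} {l m : List α} {a : α}

theorem single (h : E a x y) : ColorWalk E x [a] y := cons h (nil y)

theorem append (h : ColorWalk E x l y) (h' : ColorWalk E y m z) : ColorWalk E x (l ++ m) z := by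
  induction h with
  | nil => exact h'
  | cons e _ ih => exact cons e (ih h')

theorem reverse (hE : IsRainbowFree E) (h : ColorWalk E x l y) : ColorWalk E y l.reverse x := by
  induction h with
  | nil => exact nil _
  | cons e _ ih => simpa using ih.append (single (hE.symm e))

theorem exists_split (h : ColorWalk E x (l ++ m) z) :
    ∃ y, ColorWalk E x l y ∧ ColorWalk E y m z := by
  induction l generalizing x with
  | nil => exact ⟨x, nil x, h⟩
  | cons a l ih =>
    cases h with
    | cons e h =>
      obtain ⟨y, h₁, h₂⟩ := ih h
      exact ⟨y, cons e h₁, h₂⟩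

theorem eq_of_nil (h : ColorWalk E x [] y) : x = y := by cases h; rfl

theorem exists_of_cons (h : ColorWalk E x (a :: l) z) : ∃ y, E a x y ∧ ColorWalk E y l z := by
  cases h with
  | cons e h => exact ⟨_, e, h⟩

theorem eqvGen {r : V → V → Prop} (h : ColorWalk E x l y)
    (hr : ∀ j ∈ l, ∀ p q, E j p q → r p q) : Relation.EqvGen r x y := by
  induction h with
  | nil => exact .refl _
  | cons e _ ih =>
    exact .trans _ _ _ (.rel _ _ (hr _ (by simp) _ _ e))
      (ih fun j hj => hr j (List.mem_cons_of_mem _ hj))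

/-- A color occurring on a walk labels an edge whose first end is reached before it. -/
theorem exists_edge_of_mem (h : ColorWalk E x l y) (ha : a ∈ l) :
    ∃ l₁ l₂ p q, l = l₁ ++ a :: l₂ ∧ ColorWalk E x l₁ p ∧ E a p q ∧ ColorWalk E q l₂ y := by
  obtain ⟨l₁, l₂, rfl⟩ := List.append_of_mem ha
  obtain ⟨p, h₁, h₂⟩ := h.exists_split
  obtain ⟨q, e, h₃⟩ := h₂.exists_of_cons
  exact ⟨l₁, l₂, p, q, rfl, h₁, e, h₃⟩

end ColorWalk

/-- Image of an edge-colored multigraph under a vertex map, keeping only the colors in `P`. -/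
def mapColors {V V' : Type u} {α : Type v} (E : α → V → V → Prop) (f : V → V') (P : Set α) :
    α → V' → V' → Prop :=
  fun a p q => a ∈ P ∧ ∃ x y, f x = p ∧ f y = q ∧ E a x y

section Identify

variable {V V' : Type u} {α : Type v} {E : α → V → V → Prop} {f : V → V'} {S : Set V} {P : Set α}

theorem ColorWalk.exists_lift_or_split (hf : Function.Surjective f)
    (hfib : ∀ x y, f x = f y ↔ x = y ∨ (x ∈ S ∧ y ∈ S)) {s : V} (hs : s ∈ S) {p q : V'}
    {l : List α} (h : ColorWalk (mapColors E f P) p l q) :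
    (∃ x y, f x = p ∧ f y = q ∧ (∀ a ∈ l, a ∈ P) ∧ ColorWalk E x l y) ∨
      ∃ l₁ l₂, l = l₁ ++ l₂ ∧ ColorWalk (mapColors E f P) p l₁ (f s) ∧
        ColorWalk (mapColors E f P) (f s) l₂ q := by
  induction h with
  | nil p =>
    obtain ⟨x, rfl⟩ := hf p
    exact .inl ⟨x, x, rfl, rfl, by simp, .nil x⟩
  | @cons p p' q a l e h ih =>
    rcases ih with ⟨x, y, hx, hy, hP, hw⟩ | ⟨l₁, l₂, rfl, h₁, h₂⟩
    · obtain ⟨haP, u, w, hu, hw', huw⟩ := id e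
      rcases (hfib w x).1 (hw'.trans hx.symm) with rfl | ⟨hwS, -⟩
      · exact .inl ⟨u, y, hu, hy, by simpa using ⟨haP, hP⟩, .cons huw hw⟩
      · have : f s = p' := by rw [← hw', (hfib s w).2 (.inr ⟨hs, hwS⟩)]
        exact .inr ⟨[a], l, rfl, this ▸ .single e, this ▸ h⟩
    · exact .inr ⟨a :: l₁, l₂, rfl, .cons e h₁, h₂⟩

theorem ColorWalk.exists_lift_to_mem
    (hfib : ∀ x y, f x = f y ↔ x = y ∨ (x ∈ S ∧ y ∈ S)) {s : V} (hs : s ∈ S) {p : V'}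
    {l : List α} (h : ColorWalk (mapColors E f P) p l (f s)) (hl : l ≠ []) :
    ∃ l₁, l₁ <+: l ∧ l₁ ≠ [] ∧ (∀ a ∈ l₁, a ∈ P) ∧ ∃ x y, f x = p ∧ y ∈ S ∧
      ColorWalk E x l₁ y := by
  induction l generalizing p with
  | nil => exact absurd rfl hl
  | cons a l ih =>
    obtain ⟨p', ⟨haP, u, w, rfl, rfl, huw⟩, h⟩ := h.exists_of_cons
    by_cases hw : w ∈ S
    · exact ⟨[a], by simp, by simp, by simpa using haP, u, w, rfl, hw, .single huw⟩
    · have hl' : l ≠ [] := by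
        rintro rfl
        rcases (hfib _ _).1 h.eq_of_nil with rfl | ⟨h', -⟩
        exacts [hw hs, hw h']
      obtain ⟨l₁, hpre, -, hP, x, y, hx, hy, hwalk⟩ := ih h hl'
      rcases (hfib _ _).1 hx with rfl | ⟨-, h'⟩
      · exact ⟨a :: l₁, by simpa using hpre, by simp, by simpa using ⟨haP, hP⟩, u, y, rfl, hy,
          .cons huw hwalk⟩
      · exact absurd h' hw

theorem IsRainbowFree.mapColors (hE : IsRainbowFree E) (hf : Function.Surjective f)
    (hfib : ∀ x y, f x = f y ↔ x = y ∨ (x ∈ S ∧ y ∈ S)) {s : V} (hs : s ∈ S)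
    (hS : ∀ x ∈ S, ∀ y ∈ S, x ≠ y → ∀ l : List α, (∀ a ∈ l, a ∈ P) → l.Nodup →
      ¬ ColorWalk E x l y) :
    IsRainbowFree (mapColors E f P) where
  symm := by
    rintro a p q ⟨ha, x, y, hx, hy, h⟩
    exact ⟨ha, y, x, hy, hx, hE.symm h⟩
  multipartite := by
    rintro a p q r t ⟨ha, x, y, rfl, rfl, h⟩ ⟨-, z, w, rfl, rfl, h'⟩
    exact (hE.multipartite h h').imp (fun h => ⟨ha, _, _, rfl, rfl, h⟩)
      (fun h => ⟨ha, _, _, rfl, rfl, h⟩)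
  acyclic := by
    intro p l h hl
    have key : ∀ l, ColorWalk (_root_.mapColors E f P) (f s) l (f s) → l.Nodup → l = [] := by
      intro l h hl
      by_contra hne
      obtain ⟨l₁, hpre, hne₁, hP, x, y, hx, hy, hw⟩ := h.exists_lift_to_mem hfib hs hne
      have hxS : x ∈ S := by
        rcases (hfib _ _).1 hx with rfl | ⟨h', -⟩
        exacts [hs, h']
      have hn := hl.sublist hpre.sublist
      by_cases hxy : x = y
      · subst hxy; exact hne₁ (hE.acyclic hw hn)
      · exact hS x hxS y hy hxy l₁ hP hn hw
    rcases h.exists_lift_or_split hf hfib hs with ⟨x, y, hx, hy, hP, hw⟩ | ⟨l₁, l₂, rfl, h₁, h₂⟩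
    · rcases (hfib _ _).1 (hx.trans hy.symm) with rfl | ⟨hxS, hyS⟩
      · exact hE.acyclic hw hl
      · by_cases hxy : x = y
        · subst hxy; exact hE.acyclic hw hl
        · exact absurd hw (hS x hxS y hyS hxy l hP hl)
    · have := key _ (h₂.append h₁) (List.nodup_append_comm.1 hl)
      simp_all

/-- Two vertices of `S` may be identified: if the theorem holds on fewer vertices, then a color
in `P` stays separating when the vertices of `S` are joined and the colors off `P` removed. -/
theorem IsRainbowFree.exists_separates_of_identify {V : Type u} [Finite V]
    {E : α → V → V → Prop} {S : Set V} (hE : IsRainbowFree E)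
    (IH : ∀ (V' : Type u) [Finite V'] (E' : α → V' → V' → Prop), Nat.card V' < Nat.card V →
      IsRainbowFree E' → (∃ a x y, E' a x y) → ∃ a, (∃ x y, E' a x y) ∧ Separates E' a)
    (hS₂ : S.Nontrivial)
    (hS : ∀ x ∈ S, ∀ y ∈ S, x ≠ y → ∀ l : List α, (∀ a ∈ l, a ∈ P) → l.Nodup →
      ¬ ColorWalk E x l y)
    (hP : ∃ a ∈ P, ∃ x y, E a x y) :
    ∃ a ∈ P, (∃ x y, E a x y) ∧ ∀ x y, E a x y →
      ¬ Relation.EqvGen (fun p q => (∃ j ∈ P, j ≠ a ∧ E j p q) ∨ (p ∈ S ∧ q ∈ S)) x y := by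
  let r : Setoid V :=
    { r := fun x y => x = y ∨ (x ∈ S ∧ y ∈ S)
      iseqv := ⟨fun x => .inl rfl, by grind, by grind⟩ }
  let f : V → Quotient r := Quotient.mk r
  have hf : Function.Surjective f := Quotient.mk_surjective
  have hfib : ∀ x y, f x = f y ↔ x = y ∨ (x ∈ S ∧ y ∈ S) := fun x y => Quotient.eq (r := r)
  obtain ⟨s, hs, t, ht, hst⟩ := hS₂
  have hcard : Nat.card (Quotient r) < Nat.card V := by
    have := Fintype.ofFinite V
    have := Fintype.ofFinite (Quotient r)
    rw [Nat.card_eq_fintype_card, Nat.card_eq_fintype_card]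
    exact Fintype.card_lt_of_surjective_not_injective f hf
      fun h => hst (h ((hfib s t).2 (.inr ⟨hs, ht⟩)))
  obtain ⟨a₀, ha₀, x₀, y₀, h₀⟩ := hP
  obtain ⟨a, ⟨-, -, haP, x, y, -, -, hxy⟩, ha⟩ := IH (Quotient r) _ hcard
    (hE.mapColors hf hfib hs hS) ⟨a₀, _, _, ha₀, x₀, y₀, rfl, rfl, h₀⟩
  refine ⟨a, haP, ⟨x, y, hxy⟩, fun x y hxy h => ha _ _ ⟨haP, x, y, rfl, rfl, hxy⟩ ?_⟩
  clear hxy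
  induction h with
  | rel p q h =>
    rcases h with ⟨j, hj, hja, h⟩ | h
    · exact .rel _ _ ⟨j, hja, hj, p, q, rfl, rfl, h⟩
    · rw [(hfib p q).2 (.inr h)]; exact .refl _
  | refl => exact .refl _
  | symm _ _ _ ih => exact ih.symm
  | trans _ _ _ _ _ ih₁ ih₂ => exact ih₁.trans _ _ _ ih₂

end Identify

namespace IsRainbowFree

variable {V : Type u} {α : Type v} {E : α → V → V → Prop}

theorem irrefl (hE : IsRainbowFree E) {a : α} {x : V} : ¬ E a x x := fun h => by
  simpa using hE.acyclic (.single h) (by simp)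

theorem color_ne_of_rainbow_walk (hE : IsRainbowFree E) {a : α} {x x' y y' : V} {l : List α}
    (hx : E a x x') (hy : E a y y') (hxy : ¬ E a x y) (h : ColorWalk E x l y) (hl : l.Nodup) :
    a ∉ l := by
  intro ha
  obtain ⟨l₁, l₂, p, q, rfl, h₁, e, h₂⟩ := h.exists_edge_of_mem ha
  rcases hE.multipartite e hx with e' | e'
  · simpa using hE.acyclic (h₁.append (.single e')) (by grind [List.nodup_append, List.nodup_cons])
  · rcases hE.multipartite e' hy with e'' | e''
    · exact hxy e''
    · simpa using hE.acyclic (h₂.append (.single e''))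
        (by grind [List.nodup_append, List.nodup_cons])

theorem exists_transversal (hE : IsRainbowFree E) {b : α} {x₀ y₀ : V} (h₀ : E b x₀ y₀) :
    ∃ S : Set V, S.Nontrivial ∧ (∀ s ∈ S, ∀ t ∈ S, s ≠ t → E b s t) ∧
      (∀ s ∈ S, ∃ t, E b s t) ∧ ∀ x y, E b x y → ∃ s ∈ S, ¬ E b x s := by
  have : Nonempty V := ⟨x₀⟩
  have hinv : ∀ x, E b (Function.invFun (E b) (E b x)) = E b x :=
    fun x => Function.invFun_eq ⟨x, rfl⟩
  let S : Set V := {s | (∃ t, E b s t) ∧ Function.invFun (E b) (E b s) = s}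
  have hex : ∀ x y, E b x y → ∃ s ∈ S, ¬ E b x s := fun x y h =>
    ⟨Function.invFun (E b) (E b x), ⟨⟨y, by rwa [hinv]⟩, by rw [hinv]⟩, fun h' =>
      hE.irrefl ((congrFun (hinv x) _).mpr h')⟩
  refine ⟨S, ?_, ?_, fun s hs => hs.1, hex⟩
  · obtain ⟨s, hs, hs'⟩ := hex _ _ h₀
    obtain ⟨t, ht, ht'⟩ := hex _ _ (hE.symm h₀)
    refine ⟨s, hs, t, ht, ?_⟩
    rintro rfl
    obtain ⟨w, hw⟩ := hs.1
    rcases hE.multipartite h₀ hw with h | h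
    exacts [hs' h, ht' (hE.symm h)]
  · rintro s ⟨⟨s', hs'⟩, hs⟩ t ⟨⟨t', ht'⟩, ht⟩ hne
    by_contra hst
    refine hne ?_
    rw [← hs, ← ht]
    congr 1
    ext w
    constructor
    · intro h
      exact (hE.multipartite h ht').resolve_left hst
    · intro h
      exact (hE.multipartite h hs').resolve_left fun h => hst (hE.symm h)

/-- In a counterexample with the fewest vertices, every color class contains a vertex that forms
a part by itself in another class, but not in the given one. -/
theorem exists_singleton_part [Finite V] (hE : IsRainbowFree E)
    (IH : ∀ (V' : Type u) [Finite V'] (E' : α → V' → V' → Prop), Nat.card V' < Nat.card V →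
      IsRainbowFree E' → (∃ a x y, E' a x y) → ∃ a, (∃ x y, E' a x y) ∧ Separates E' a)
    (hbad : ∀ a x y, E a x y → ¬ Separates E a) {b : α} {x₀ y₀ : V} (h₀ : E b x₀ y₀) :
    ∃ d c, (∃ y, E b d y) ∧ (∃ y, E c d y) ∧ (∀ x y, E c x y → x ≠ d → E c d x) ∧
      ∃ x y, x ≠ d ∧ E b x y ∧ ¬ E b d x := by
  have hconn : ∀ x y, x ≠ y → ∃ l : List α, l.Nodup ∧ ColorWalk E x l y := by
    intro x y hxy
    by_contra! hno
    obtain ⟨a, -, ⟨p, q, hpq⟩, ha⟩ := hE.exists_separates_of_identify (S := {x, y})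
      (P := Set.univ) IH (Set.nontrivial_pair hxy) (by
        rintro u (rfl | rfl) v (rfl | rfl) hne l - hl hw
        · exact hne rfl
        · exact hno l hl hw
        · exact hno l.reverse (List.nodup_reverse.2 hl) (hw.reverse hE)
        · exact hne rfl) ⟨b, trivial, _, _, h₀⟩
    refine hbad a p q hpq fun u w huw h => ha u w huw (h.mono ?_)
    rintro u w ⟨j, hj, h⟩
    exact .inl ⟨j, trivial, hj, h⟩
  obtain ⟨S, hS₂, hSb, hSupp, hSex⟩ := hE.exists_transversal h₀
  have hother : ∃ a ∈ {j | j ≠ b}, ∃ x y, E a x y := by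
    by_contra! hno
    refine hbad b _ _ h₀ fun u w huw h => ?_
    have : u = w := by
      clear huw
      induction h with
      | rel p q h => obtain ⟨j, hj, h⟩ := h; exact absurd h (hno j hj p q)
      | refl => rfl
      | symm _ _ _ ih => exact ih.symm
      | trans _ _ _ _ _ h₁ h₂ => exact h₁.trans h₂
    exact hE.irrefl (this ▸ huw)
  obtain ⟨c, hcb, ⟨xc, yc, hxyc⟩, hgood⟩ := hE.exists_separates_of_identify (S := S)
    (P := {j | j ≠ b}) IH hS₂ (by
      intro s hs t ht hne l hP hl hw
      have := hE.acyclic (.cons (hSb t ht s hs hne.symm) hw)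
        (List.nodup_cons.2 ⟨fun h => hP _ h rfl, hl⟩)
      simp at this) hother
  set r : V → V → Prop :=
    fun p q => (∃ j ∈ {j | j ≠ b}, j ≠ c ∧ E j p q) ∨ (p ∈ S ∧ q ∈ S)
  have hcb : c ≠ b := hcb
  obtain ⟨s₀, hs₀⟩ := hS₂.nonempty
  have hSS : ∀ s ∈ S, Relation.EqvGen r s₀ s := fun s hs => .rel _ _ (.inr ⟨hs₀, hs⟩)
  have hstep : ∀ j p q, j ≠ b → j ≠ c → E j p q → Relation.EqvGen r p q :=
    fun j p q h₁ h₂ h => .rel _ _ (.inl ⟨j, h₁, h₂, h⟩)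
  have hwalk : ∀ {l : List α} {p q}, ColorWalk E p l q → b ∉ l → c ∉ l →
      Relation.EqvGen r p q := fun h hb hc =>
    h.eqvGen fun j hj p q e => .inl ⟨j, fun h => hb (h ▸ hj), fun h => hc (h ▸ hj), e⟩
  have hclass : ∀ j p q p' q', j ≠ b → j ≠ c → E j p q → E j p' q' → Relation.EqvGen r p p' := by
    intro j p q p' q' h₁ h₂ h h'
    rcases hE.multipartite h h' with e | e
    · exact hstep j _ _ h₁ h₂ e
    · exact (hstep j _ _ h₁ h₂ h).trans _ _ _ (hstep j _ _ h₁ h₂ e).symm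
  obtain ⟨d, yd, hdyd, hd⟩ : ∃ d y, E b d y ∧ ¬ Relation.EqvGen r s₀ d := by
    by_contra! hall
    refine hbad c _ _ hxyc fun u w huw h => hgood u w huw ?_
    clear huw
    induction h with
    | rel p q h =>
      obtain ⟨j, hj, h⟩ := h
      by_cases hjb : j = b
      · subst hjb
        exact (hall p q h).symm.trans _ _ _ (hall q p (hE.symm h))
      · exact hstep j p q hjb hj h
    | refl => exact .refl _
    | symm _ _ _ ih => exact ih.symm
    | trans _ _ _ _ _ h₁ h₂ => exact h₁.trans _ _ _ h₂
  obtain ⟨x, hxS, hdx⟩ := hSex d yd hdyd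
  obtain ⟨yx, hxyx⟩ := hSupp x hxS
  have hdxne : x ≠ d := by rintro rfl; exact hd (hSS _ hxS)
  obtain ⟨l, hl, hw⟩ := hconn d x hdxne.symm
  have hbl := hE.color_ne_of_rainbow_walk hdyd hxyx hdx hw hl
  have hcl : c ∈ l := by
    by_contra hcl
    exact hd ((hSS _ hxS).trans _ _ _ (hwalk hw hbl hcl).symm)
  obtain ⟨l₁, l₂, b₀, a₀, rfl, hw₁, hba, hw₂⟩ := hw.exists_edge_of_mem hcl
  have hdb₀ : Relation.EqvGen r d b₀ := hwalk hw₁ (by grind) (by grind)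
  have ha₀ : Relation.EqvGen r s₀ a₀ :=
    (hSS x hxS).trans _ _ _ (hwalk hw₂ (by grind) (by grind)).symm
  have hkey : ∀ y a m, E b y d → Relation.EqvGen r s₀ y → E c b₀ a → ColorWalk E y m a →
      m.Nodup → b ∉ m → c ∉ m → False := by
    intro y a m hyd hy hba' hm hmn hbm hcm
    have hdisj : ∀ j ∈ l₁, j ∉ m := by
      intro j hj hj'
      obtain ⟨k₁, k₂, p, q, rfl, h₁, e, -⟩ := hw₁.exists_edge_of_mem hj
      obtain ⟨k₃, k₄, p', q', rfl, h₁', e', -⟩ := hm.exists_edge_of_mem hj'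
      have hjb : j ≠ b := by grind
      have hjc : j ≠ c := by grind [List.nodup_append, List.nodup_cons]
      refine hd (hy.trans _ _ _ ((hwalk h₁' (by grind) (by grind)).trans _ _ _
        ((hclass j _ _ _ _ hjb hjc e' e).trans _ _ _ (hwalk h₁ (by grind) ?_).symm)))
      grind [List.nodup_append, List.nodup_cons]
    have hcycle := hw₁.append (.cons hba' ((hm.reverse hE).append (.single hyd)))
    simpa using hE.acyclic hcycle (List.nodup_append_cons_reverse_append hl hbl hmn hbm hcm hdisj)
  have hbside : ∀ y, E b y d → Relation.EqvGen r s₀ y := by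
    intro y hyd
    obtain ⟨s, hs, hys⟩ := hSex y d hyd
    obtain ⟨s', hs'⟩ := hSupp s hs
    by_contra hy
    obtain ⟨m, hm, hwm⟩ := hconn s y (by rintro rfl; exact hy (hSS _ hs))
    have hbm := hE.color_ne_of_rainbow_walk hs' hyd (fun h => hys (hE.symm h)) hwm hm
    have hcm : c ∈ m := by
      by_contra hcm
      exact hy ((hSS s hs).trans _ _ _ (hwalk hwm hbm hcm))
    obtain ⟨m₁, m₂, a₁, q, rfl, hm₁, e, -⟩ := hwm.exists_edge_of_mem hcm
    have hcm₁ : c ∉ m₁ := by grind [List.nodup_append, List.nodup_cons]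
    have hsa : Relation.EqvGen r s a₁ := hwalk hm₁ (by grind) hcm₁
    have ha : E c b₀ a₁ := by
      rcases hE.multipartite hba e with h | h
      · exact h
      · exact absurd (hsa.symm.trans _ _ _ ((hSS s hs).symm.trans _ _ _ ha₀)) (hgood _ _ h)
    have hsd : E b s d := (hE.multipartite hyd hs').resolve_left hys
    exact hkey s a₁ m₁ hsd (hSS s hs) ha hm₁ (by grind) (by grind) hcm₁
  have hDb : ∀ z y, Relation.EqvGen r d z → E b z y → E b d y := by
    intro z y hz hzy
    rcases hE.multipartite hzy hdyd with h | h
    · exact absurd ((hbside z h).trans _ _ _ hz.symm) hd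
    · exact h
  have hDc : ∀ z a, Relation.EqvGen r d z → E c z a → E c b₀ a := by
    intro z a hz hza
    rcases hE.multipartite hza hba with h | h
    · exact absurd (hz.symm.trans _ _ _ hdb₀) (hgood _ _ h)
    · exact h
  have hDout : ∀ j z t, Relation.EqvGen r d z → ¬ Relation.EqvGen r d t → E j z t →
      j = b ∨ j = c := by
    intro j z t hz ht h
    by_contra! hj
    exact ht (hz.trans _ _ _ (hstep j z t hj.1 hj.2 h))
  have hD : ∀ z, Relation.EqvGen r d z → z = d := by
    by_contra! hne
    obtain ⟨z, hz, hzd⟩ := hne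
    obtain ⟨a, haP, ⟨p, q, hpq⟩, ha⟩ := hE.exists_separates_of_identify
      (S := {z | Relation.EqvGen r d z})
      (P := {j | ∀ u v, E j u v → Relation.EqvGen r d u → ¬ Relation.EqvGen r d v}) IH
      ⟨d, .refl _, z, hz, hzd.symm⟩ (by
        intro s hs s' hs' hss l hP hl hw
        match l, hw with
        | [], hw => exact hss hw.eq_of_nil
        | c₁ :: l', hw =>
          obtain ⟨t, e₁, hw⟩ := hw.exists_of_cons
          have ht := hP c₁ (by simp) _ _ e₁ hs
          rcases List.eq_nil_or_concat' l' with rfl | ⟨m, c₂, rfl⟩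
          · exact ht (hw.eq_of_nil ▸ hs')
          · obtain ⟨t', hm, hw'⟩ := hw.exists_split
            obtain ⟨s'', e₂, hw'⟩ := hw'.exists_of_cons
            obtain rfl := hw'.eq_of_nil
            have ht' := hP c₂ (by simp) _ _ (hE.symm e₂) hs'
            obtain ⟨hc₁, hl⟩ := List.nodup_cons.1 hl
            obtain ⟨hc₂, hmn⟩ := List.nodup_cons.1 (List.nodup_append_comm.1 hl)
            simp only [List.mem_append, List.mem_singleton, not_or] at hc₁
            rcases hDout _ _ _ hs ht e₁ with rfl | rfl <;>
              rcases hDout _ _ _ hs' ht' (hE.symm e₂) with rfl | rfl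
            · exact hc₁.2 rfl
            · have hdt := hE.symm (hDb _ _ hs e₁)
              exact hkey t t' m hdt (hbside t hdt) (hDc _ _ hs' (hE.symm e₂)) hm hmn
                hc₁.1 hc₂
            · have hdt := hE.symm (hDb _ _ hs' (hE.symm e₂))
              exact hkey t' t m.reverse hdt (hbside t' hdt) (hDc _ _ hs e₁)
                (hm.reverse hE) (List.nodup_reverse.2 hmn)
                (mt List.mem_reverse.1 hc₂) (mt List.mem_reverse.1 hc₁.1)
            · exact hc₁.2 rfl)
      ⟨c, fun u v huv hu hv => hgood u v huv (hu.symm.trans _ _ _ hv), xc, yc, hxyc⟩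
    refine hbad a p q hpq fun u w huw h => ha u w huw (h.mono ?_)
    rintro u w ⟨j, hja, huw⟩
    by_cases hjP : ∀ u v, E j u v → Relation.EqvGen r d u → ¬ Relation.EqvGen r d v
    · exact .inl ⟨j, hjP, hja, huw⟩
    · push Not at hjP
      obtain ⟨u', v', huv', hu', hv'⟩ := hjP
      have hjb : j ≠ b := by
        rintro rfl
        exact hd ((hbside _ (hE.symm (hDb _ _ hu' huv'))).trans _ _ _ hv'.symm)
      have hjc : j ≠ c := by
        rintro rfl
        exact hgood _ _ huv' (hu'.symm.trans _ _ _ hv')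
      exact .inr ⟨hu'.trans _ _ _ (hclass j _ _ _ _ hjb hjc huv' huw),
        hu'.trans _ _ _ (hclass j _ _ _ _ hjb hjc huv' (hE.symm huw))⟩
  obtain rfl := hD b₀ hdb₀
  refine ⟨b₀, c, ⟨yd, hdyd⟩, ⟨a₀, hba⟩, ?_, x, yx, hdxne, hxyx, hdx⟩
  intro w y hwy hwd
  by_contra hdw
  obtain ⟨m, hm, hwm⟩ := hconn b₀ w hwd.symm
  have hcm := hE.color_ne_of_rainbow_walk hba hwy hdw hwm hm
  match m, hwm with
  | [], hwm => exact hwd hwm.eq_of_nil.symm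
  | j :: m, hwm =>
    obtain ⟨t, e, hwm⟩ := hwm.exists_of_cons
    have ht : ¬ Relation.EqvGen r b₀ t := fun h => hE.irrefl (hD t h ▸ e)
    obtain rfl : j = b := (hDout _ _ _ (.refl _) ht e).resolve_right (by grind)
    have h₁ := hwalk hwm (by grind) (by grind)
    have h₂ := hbside t (hE.symm e)
    rcases hE.multipartite hba hwy with h | h
    · exact hdw h
    · exact hgood _ _ h (h₁.symm.trans _ _ _ (h₂.symm.trans _ _ _ ha₀))

theorem exists_separates [Finite V] (hE : IsRainbowFree E) (hne : ∃ a x y, E a x y) :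
    ∃ a, (∃ x y, E a x y) ∧ Separates E a := by
  induction hn : Nat.card V using Nat.strong_induction_on generalizing V with
  | _ n ih =>
  subst hn
  by_contra! hbad
  have hbad' : ∀ a x y, E a x y → ¬ Separates E a := fun a x y h => hbad a ⟨x, y, h⟩
  have key : ∀ b : {a // ∃ x y, E a x y}, ∃ (d : V) (c : {a // ∃ x y, E a x y}),
      (∃ y, E b d y) ∧ (∀ x y, E c x y → x ≠ d → E c d x) ∧
      ∃ x y, x ≠ d ∧ E b x y ∧ ¬ E b d x := by
    rintro ⟨b, x₀, y₀, h₀⟩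
    obtain ⟨d, c, h₁, h₂, h₃⟩ := hE.exists_singleton_part
      (fun V' _ E' h hE' hne' => ih _ h hE' hne' rfl) hbad' h₀
    exact ⟨d, ⟨c, d, h₂⟩, h₁, h₃⟩
  choose d g hdsupp hg hd using key
  have hstep : ∀ b, E (g b) (d b) (d (g b)) := by
    intro b
    obtain ⟨y, hy⟩ := hdsupp (g b)
    refine hg b _ y hy fun h => ?_
    obtain ⟨x, y, hx, hxy, hn⟩ := hd (g b)
    rw [h] at hx hn
    exact hn (hg b x y hxy hx)
  have hwalk : ∀ b n, ColorWalk E (d b) ((List.range n).map fun i => (g^[i + 1] b).1)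
      (d (g^[n] b)) := by
    intro b n
    induction n with
    | zero => exact .nil _
    | succ n ih =>
      rw [List.range_succ, List.map_append]
      refine ih.append (.single ?_)
      simp only [Function.iterate_succ_apply']
      exact hstep _
  have : Finite {a // ∃ x y, E a x y} := by
    choose p q hpq using fun a : {a // ∃ x y, E a x y} => a.2
    refine Finite.of_injective (fun a => (p a, q a)) fun a a' h => ?_
    simp only [Prod.mk.injEq] at h
    by_contra hne
    have h' := hpq a'
    rw [← h.1, ← h.2] at h'
    have := hE.acyclic (.cons (hpq a) (.single (hE.symm h'))) (by
      simpa using fun h => hne (Subtype.ext h))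
    simp at this
  obtain ⟨a, x, y, h⟩ := hne
  obtain ⟨b, hb⟩ : ∃ b, b ∈ Function.periodicPts g := by
    obtain ⟨i, j, hij, h⟩ := Finite.exists_ne_map_eq_of_infinite fun n : ℕ => g^[n] ⟨a, x, y, h⟩
    wlog hlt : i < j generalizing i j
    · exact this j i hij.symm h.symm (by omega)
    refine ⟨_, Function.mk_mem_periodicPts (Nat.sub_pos_of_lt hlt) (x := g^[i] ⟨a, x, y, ‹_›⟩) ?_⟩
    rw [Function.IsPeriodicPt, Function.IsFixedPt, ← Function.iterate_add_apply,
      Nat.sub_add_cancel hlt.le]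
    exact h.symm
  have hpos := Function.minimalPeriod_pos_of_mem_periodicPts hb
  have hw := hwalk b (Function.minimalPeriod g b)
  rw [Function.iterate_minimalPeriod] at hw
  have hnil := hE.acyclic hw (by
    refine List.Nodup.map_on ?_ List.nodup_range
    intro i hi j hj hij
    have hij := Subtype.ext hij
    rw [List.mem_range] at hi hj
    have hper : ∀ i, g^[Function.minimalPeriod g b - 1] (g^[i + 1] b) = g^[i] b := by
      intro i
      rw [← Function.iterate_add_apply,
        show Function.minimalPeriod g b - 1 + (i + 1) = i + Function.minimalPeriod g b by omega,
        Function.iterate_add_apply, Function.iterate_minimalPeriod]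
    exact Function.iterate_injOn_Iio_minimalPeriod hi hj (by
      simpa only [hper] using congrArg (g^[Function.minimalPeriod g b - 1]) hij))
  simp at hnil
  omega

end IsRainbowFree

theorem ColorWalk.exists_walk {V : Type u} {α : Type v} {G : SimpleGraph V} {c : Sym2 V → α}
    {x y : V} {l : List α} (h : ColorWalk (fun a x y => G.Adj x y ∧ c s(x, y) = a) x l y) :
    ∃ p : G.Walk x y, p.edges.map c = l := by
  induction h with
  | nil x => exact ⟨.nil, rfl⟩
  | cons e _ ih =>
    obtain ⟨p, rfl⟩ := ih
    exact ⟨.cons e.1 p, by simp [e.2]⟩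

/-- Rainbow-acyclicity and a structural theorem for multipartite
decompositions. The hypothesis `hmp` states that each color class is a complete
multipartite graph: among the vertices of the class of color `a`,
non-adjacency (within the class) is transitive, so that it is an equivalence
relation whose classes are the parts. The conclusion says there is a color
class `H` whose removal disconnects any two of its parts: any two vertices
joined by an edge of `H` (i.e. lying in different parts) are disconnected in
`G − E(H)`. -/
theorem stmt17 {V α : Type*} [Fintype V] (G : SimpleGraph V) (c : Sym2 V → α)
    (hE : G.edgeSet.Nonempty)
    (hmp : ∀ (a : α) (u v w : V),
      (∃ e ∈ G.edgeSet, c e = a ∧ u ∈ e) →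
      (∃ e ∈ G.edgeSet, c e = a ∧ v ∈ e) →
      (∃ e ∈ G.edgeSet, c e = a ∧ w ∈ e) →
      u ≠ v → v ≠ w → u ≠ w →
      ¬ (s(u, v) ∈ G.edgeSet ∧ c s(u, v) = a) →
      ¬ (s(v, w) ∈ G.edgeSet ∧ c s(v, w) = a) →
      ¬ (s(u, w) ∈ G.edgeSet ∧ c s(u, w) = a))
    (hnr : ¬ ∃ (v : V) (C : G.Walk v v), C.IsCycle ∧ (C.edges.map c).Nodup) :
    ∃ a : α, (∃ e ∈ G.edgeSet, c e = a) ∧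
      ∀ u w : V, s(u, w) ∈ G.edgeSet → c s(u, w) = a →
        ¬ (G.deleteEdges {e | c e = a}).Reachable u w := by
  classical
  let E : α → V → V → Prop := fun a x y => G.Adj x y ∧ c s(x, y) = a
  have hsymm : ∀ {a x y}, E a x y → E a y x := by
    rintro a x y ⟨h, rfl⟩
    exact ⟨h.symm, by rw [Sym2.eq_swap]⟩
  have hsupp : ∀ {a x y}, E a x y → ∃ e ∈ G.edgeSet, c e = a ∧ x ∈ e :=
    fun {a x y} h => ⟨s(x, y), h.1, h.2, by simp⟩
  have hfree : IsRainbowFree E :=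
    { symm := hsymm
      multipartite := by
        intro a x y z w hxy hzw
        by_contra! hno
        have hxz : x ≠ z := by rintro rfl; exact hno.2 hxy
        have hzy : z ≠ y := by rintro rfl; exact hno.1 hxy
        exact hmp a x z y (hsupp hxy) (hsupp hzw) (hsupp (hsymm hxy)) hxz hzy hxy.1.ne
          hno.1 hno.2 hxy
      acyclic := by
        intro x l h hl
        obtain ⟨p, rfl⟩ := h.exists_walk
        by_contra hp
        refine hnr ⟨x, p.cycleBypass, SimpleGraph.Walk.IsTrail.isCycle_cycleBypass ?_ ?_,
          hl.sublist (p.edges_cycleBypass_sublist_edges.map c)⟩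
        · rintro rfl
          exact hp rfl
        · exact ⟨hl.of_map c⟩ }
  obtain ⟨e, he⟩ := hE
  induction e using Sym2.ind with
  | _ x y =>
  obtain ⟨a, ⟨x, y, hxy⟩, ha⟩ := hfree.exists_separates ⟨c s(x, y), x, y, he, rfl⟩
  refine ⟨a, ⟨s(x, y), hxy.1, hxy.2⟩, fun u w huw hc hreach => ha u w ⟨huw, hc⟩ ?_⟩
  rw [SimpleGraph.reachable_iff_reflTransGen] at hreach
  clear huw hc
  induction hreach with
  | refl => exact .refl _
  | tail _ h ih =>
    rw [SimpleGraph.deleteEdges_adj] at h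
    exact ih.trans _ _ _ (.rel _ _ ⟨_, fun h' => h.2 h', h.1, rfl⟩)
end
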